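/- arXiv:math/0510394 — 12 statements merged into one kernel-verified Lean document; each statement's English description precedes it below -/
import Mathlib

section
/- A configuration of t pebbles on the vertices of the complete graph K_n is cover solvable if and only if X + t ≥ 2n, where X is the number of vertices on which an odd number of pebbles is placed. -/
/-- A single pebbling move on a graph `G`: two pebbles are removed from a vertex `u`
and one pebble is placed on an adjacent vertex `v`. -/
def PebblingMove {V : Type*} [DecidableEq V] (G : SimpleGraph V) (C C' : V → ℕ) : Prop :=
  ∃ u v : V, G.Adj u v ∧ 2 ≤ C u ∧
    C' = Function.update (Function.update C u (C u - 2)) v (C v + 1)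

/-- A configuration is cover solvable if some finite sequence of pebbling moves
results in a configuration with at least one pebble on every vertex. -/
def CoverSolvable {V : Type*} [DecidableEq V] (G : SimpleGraph V) (C : V → ℕ) : Prop :=
  ∃ C' : V → ℕ, Relation.ReflTransGen (PebblingMove G) C C' ∧ ∀ v, 1 ≤ C' v

/-- The sum of a vertex statistic before and after a pebbling move from `u` to `v`. -/
theorem sum_pebblingMove {V : Type*} [DecidableEq V] [Fintype V] (F : ℕ → ℕ) (C : V → ℕ)
    {u v : V} (huv : u ≠ v) :
    ∑ x, F (Function.update (Function.update C u (C u - 2)) v (C v + 1) x) + F (C u) + F (C v) =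
      ∑ x, F (C x) + F (C u - 2) + F (C v + 1) := by
  have hu : u ∈ Finset.univ.erase v := by simp [huv]
  rw [← Finset.add_sum_erase _ _ (Finset.mem_univ v), ← Finset.add_sum_erase _ _ hu,
    ← Finset.add_sum_erase _ (fun x => F (C x)) (Finset.mem_univ v),
    ← Finset.add_sum_erase _ (fun x => F (C x)) hu]
  have hrest : ∑ x ∈ (Finset.univ.erase v).erase u,
      F (Function.update (Function.update C u (C u - 2)) v (C v + 1) x) =
      ∑ x ∈ (Finset.univ.erase v).erase u, F (C x) := by
    refine Finset.sum_congr rfl fun x hx => ?_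
    simp only [Finset.mem_erase] at hx
    rw [Function.update_of_ne hx.2.1, Function.update_of_ne hx.1]
  rw [hrest, Function.update_self, Function.update_of_ne huv, Function.update_self]
  ring

/-- The number of odd stacks plus the weight is the sum of the stacks rounded up to even. -/
theorem card_odd_add_sum {V : Type*} [Fintype V] (C : V → ℕ) :
    (Finset.univ.filter fun v => Odd (C v)).card + ∑ v, C v = ∑ v, (C v + C v % 2) := by
  rw [Finset.card_filter, ← Finset.sum_add_distrib]
  refine Finset.sum_congr rfl fun v _ => ?_
  split_ifs with h
  · rw [Nat.odd_iff] at h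
    omega
  · rw [Nat.odd_iff] at h
    omega

/-- A pebbling move does not increase the sum of the stacks rounded up to even. -/
theorem PebblingMove.sum_add_mod_two_le {V : Type*} [DecidableEq V] [Fintype V]
    {G : SimpleGraph V} {C C' : V → ℕ} (h : PebblingMove G C C') :
    ∑ v, (C' v + C' v % 2) ≤ ∑ v, (C v + C v % 2) := by
  obtain ⟨u, v, huv, hu, rfl⟩ := h
  have := sum_pebblingMove (fun c => c + c % 2) C huv.ne
  omega

theorem CoverSolvable.two_mul_card_le {V : Type*} [DecidableEq V] [Fintype V]
    {G : SimpleGraph V} {C : V → ℕ} (h : CoverSolvable G C) :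
    2 * Fintype.card V ≤ ∑ v, (C v + C v % 2) := by
  obtain ⟨C', hmoves, hpos⟩ := h
  have hmono : ∑ v, (C' v + C' v % 2) ≤ ∑ v, (C v + C v % 2) := by
    clear hpos
    induction hmoves with
    | refl => exact le_rfl
    | tail _ hmove ih => exact hmove.sum_add_mod_two_le.trans ih
  refine le_trans ?_ hmono
  have hcard := Finset.card_nsmul_le_sum Finset.univ (fun v => C' v + C' v % 2) 2
    fun v _ => by
      have := hpos v
      omega
  rw [smul_eq_mul, Finset.card_univ] at hcard
  omega

theorem coverSolvable_top_of_two_mul_card_le {V : Type*} [DecidableEq V] [Fintype V]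
    (C : V → ℕ) (h : 2 * Fintype.card V ≤ ∑ v, (C v + C v % 2)) :
    CoverSolvable (⊤ : SimpleGraph V) C := by
  induction hs : ∑ v, C v using Nat.strong_induction_on generalizing C with
  | _ s ih =>
  by_cases hpos : ∀ v, 1 ≤ C v
  · exact ⟨C, .refl, hpos⟩
  push Not at hpos
  obtain ⟨v, hv⟩ := hpos
  obtain ⟨u, hu⟩ : ∃ u, 3 ≤ C u := by
    by_contra! hsmall
    have hlt : ∑ x, (C x + C x % 2) < ∑ _x : V, 2 :=
      Finset.sum_lt_sum (fun x _ => by have := hsmall x; omega)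
        ⟨v, Finset.mem_univ v, by omega⟩
    rw [Finset.sum_const, smul_eq_mul, Finset.card_univ] at hlt
    omega
  have huv : u ≠ v := by
    rintro rfl
    omega
  have hround := sum_pebblingMove (fun c => c + c % 2) C huv
  have hweight := sum_pebblingMove (fun c => c) C huv
  obtain ⟨C', hmoves, hC'⟩ := ih
    (∑ x, Function.update (Function.update C u (C u - 2)) v (C v + 1) x) (by omega)
    (Function.update (Function.update C u (C u - 2)) v (C v + 1)) (by omega) rfl
  exact ⟨C', .head ⟨u, v, huv, by omega, rfl⟩ hmoves, hC'⟩

/-- A configuration of `t` pebbles on the vertices of the complete graph `K_n` is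
cover solvable if and only if `X + t ≥ 2n`, where `X` is the number of vertices
on which an odd number of pebbles is placed. -/
theorem coverSolvable_completeGraph_iff (n t : ℕ) (C : Fin n → ℕ)
    (hC : ∑ v, C v = t) :
    CoverSolvable (⊤ : SimpleGraph (Fin n)) C ↔
      (Finset.univ.filter fun v => Odd (C v)).card + t ≥ 2 * n := by
  rw [← hC, card_odd_add_sum]
  constructor
  · intro h
    simpa using h.two_mul_card_le
  · intro h
    exact coverSolvable_top_of_two_mul_card_le C (by simpa using h)
end

section
/- A configuration of t pebbles on the vertices of the complete graph K_n is cover solvable if and only if ∑_{i≥0} i·(Y_{2i+1} + Y_{2i+2}) ≥ Y_0, where Y_j denotes the number of vertices on which exactly j pebbles are placed. -/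
/-- `Y j` is the number of vertices on which exactly `j` pebbles are placed. -/
def stackCount {n : ℕ} (C : Fin n → ℕ) (j : ℕ) : ℕ :=
  (Finset.univ.filter fun v => C v = j).card

/-- The surplus of a stack of `c` pebbles: the number of moves it can supply while keeping one
pebble, counted as `-1` for an empty stack. -/
def stackSurplus (c : ℕ) : ℤ := ((c : ℤ) - 1) / 2

section Pebbling

variable {V : Type*} [Fintype V] [DecidableEq V]

theorem sum_comp_update (g : ℕ → ℤ) (C : V → ℕ) (u : V) (a : ℕ) :
    ∑ w, g (Function.update C u a w) = ∑ w, g (C w) + (g a - g (C u)) := by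
  rw [← Finset.add_sum_erase _ _ (Finset.mem_univ u),
    ← Finset.add_sum_erase _ (fun w => g (C w)) (Finset.mem_univ u)]
  have h : ∑ w ∈ Finset.univ.erase u, g (Function.update C u a w) =
      ∑ w ∈ Finset.univ.erase u, g (C w) :=
    Finset.sum_congr rfl fun w hw => by
      rw [Function.update_of_ne (Finset.ne_of_mem_erase hw)]
  rw [h, Function.update_self]
  ring

theorem sum_comp_pebblingMove (g : ℕ → ℤ) (C : V → ℕ) {u v : V} (huv : u ≠ v) :
    ∑ w, g (Function.update (Function.update C u (C u - 2)) v (C v + 1) w) =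
      ∑ w, g (C w) + (g (C u - 2) - g (C u)) + (g (C v + 1) - g (C v)) := by
  rw [sum_comp_update, sum_comp_update, Function.update_of_ne huv.symm]

theorem PebblingMove.sum_stackSurplus_le {G : SimpleGraph V} {C C' : V → ℕ}
    (h : PebblingMove G C C') :
    ∑ w, stackSurplus (C' w) ≤ ∑ w, stackSurplus (C w) := by
  obtain ⟨u, v, huv, hu, rfl⟩ := h
  rw [sum_comp_pebblingMove _ _ huv.ne]
  unfold stackSurplus
  omega

theorem CoverSolvable.sum_stackSurplus_nonneg {G : SimpleGraph V} {C : V → ℕ}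
    (h : CoverSolvable G C) : 0 ≤ ∑ w, stackSurplus (C w) := by
  obtain ⟨C', hmoves, hcover⟩ := h
  induction hmoves using Relation.ReflTransGen.head_induction_on with
  | refl =>
    refine Finset.sum_nonneg fun w _ => ?_
    have := hcover w
    unfold stackSurplus
    omega
  | head hmove _ ih => exact ih.trans hmove.sum_stackSurplus_le

theorem coverSolvable_top_of_sum_stackSurplus_nonneg (C : V → ℕ)
    (h : 0 ≤ ∑ w, stackSurplus (C w)) : CoverSolvable (⊤ : SimpleGraph V) C := by
  induction hs : ∑ w, C w using Nat.strong_induction_on generalizing C with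
  | _ s ih =>
    by_cases hcover : ∀ v, 1 ≤ C v
    · exact ⟨C, .refl, hcover⟩
    push Not at hcover
    obtain ⟨v, hv⟩ := hcover
    obtain ⟨u, hu⟩ : ∃ u, 3 ≤ C u := by
      by_contra! hsmall
      refine absurd h (not_le.mpr (Finset.sum_neg' (fun w _ => ?_) ⟨v, Finset.mem_univ v, ?_⟩))
      · have := hsmall w
        unfold stackSurplus
        omega
      · unfold stackSurplus
        omega
    have huv : u ≠ v := by
      rintro rfl
      omega
    have hsurplus := sum_comp_pebblingMove stackSurplus C huv
    have hcount := sum_comp_pebblingMove Nat.cast C huv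
    simp only [← Nat.cast_sum] at hcount
    have hnonneg : 0 ≤ ∑ w, stackSurplus
        (Function.update (Function.update C u (C u - 2)) v (C v + 1) w) := by
      rw [hsurplus]
      unfold stackSurplus at h ⊢
      omega
    obtain ⟨C', hmoves, hcover'⟩ := ih _ (by rw [← hs]; omega) _ hnonneg rfl
    exact ⟨C', .head ⟨u, v, huv, by omega, rfl⟩ hmoves, hcover'⟩

end Pebbling

theorem stackSurplus_eq_sum {c t : ℕ} (h : c ≤ t) :
    stackSurplus c = ∑ i ∈ Finset.range (t + 1),
      (i : ℤ) * ((if c = 2 * i + 1 then 1 else 0) + (if c = 2 * i + 2 then 1 else 0)) -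
        (if c = 0 then 1 else 0) := by
  rw [Finset.sum_eq_single ((c - 1) / 2)]
  · unfold stackSurplus
    split_ifs <;> omega
  · intro i _ hi
    rw [if_neg (by omega), if_neg (by omega)]
    simp
  · intro hmem
    exact absurd (Finset.mem_range.mpr (by omega)) hmem

theorem sum_stackSurplus_eq {n t : ℕ} (C : Fin n → ℕ) (h : ∀ v, C v ≤ t) :
    ∑ v, stackSurplus (C v) =
      ((∑ i ∈ Finset.range (t + 1),
        i * (stackCount C (2 * i + 1) + stackCount C (2 * i + 2)) : ℕ) : ℤ) -
          stackCount C 0 := by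
  have hcount (j : ℕ) : (stackCount C j : ℤ) = ∑ v, if C v = j then 1 else 0 := by
    simp [stackCount]
  push_cast
  simp only [hcount, ← Finset.sum_add_distrib, Finset.mul_sum]
  rw [Finset.sum_comm, ← Finset.sum_sub_distrib]
  exact Finset.sum_congr rfl fun v _ => stackSurplus_eq_sum (h v)

/-- A configuration of `t` pebbles on the vertices of the complete graph `K_n` is
cover solvable if and only if `∑_{i ≥ 0} i·(Y_{2i+1} + Y_{2i+2}) ≥ Y_0`, where
`Y_j` is the number of vertices on which exactly `j` pebbles are placed.  (Since no
vertex can carry more than `t` pebbles, all terms with `i > t` vanish, so the sum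
may be taken over `0 ≤ i ≤ t`.) -/
theorem coverSolvable_completeGraph_iff_stacks (n t : ℕ) (C : Fin n → ℕ)
    (hC : ∑ v, C v = t) :
    CoverSolvable (⊤ : SimpleGraph (Fin n)) C ↔
      ∑ i ∈ Finset.range (t + 1), i * (stackCount C (2 * i + 1) + stackCount C (2 * i + 2))
        ≥ stackCount C 0 := by
  have hle (v : Fin n) : C v ≤ t :=
    hC ▸ Finset.single_le_sum (fun w _ => Nat.zero_le (C w)) (Finset.mem_univ v)
  have hsum := sum_stackSurplus_eq C hle
  constructor
  · intro h
    have := h.sum_stackSurplus_nonneg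
    omega
  · intro h
    exact coverSolvable_top_of_sum_stackSurplus_nonneg C (by omega)
end

section
/- When t pebbles are placed independently and uniformly at random on n ≥ 2 vertices (Maxwell Boltzmann scheme), the probability that two fixed distinct vertices both receive an odd number of pebbles equals (1/4)·(1 + (1 − 4/n)^t − 2(1 − 2/n)^t). -/
/-- For an assignment `f` of `t` distinguishable pebbles to `n` vertices
(pebble `p` is placed on vertex `f p`), `oddAt f v` says that vertex `v`
receives an odd number of pebbles. -/
def oddAt {n t : ℕ} (f : Fin t → Fin n) (v : Fin n) : Prop :=
  Odd ((Finset.univ.filter fun p : Fin t => f p = v).card)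

instance {n t : ℕ} (f : Fin t → Fin n) (v : Fin n) : Decidable (oddAt f v) := by
  unfold oddAt; infer_instance

/-- The sign of vertex `i`, multiplied over all pebbles, records the parity of the stack at `i`. -/
theorem prod_sign_eq_ite_oddAt {n t : ℕ} (f : Fin t → Fin n) (i : Fin n) :
    ∏ p, (if f p = i then (-1 : ℝ) else 1) = if oddAt f i then -1 else 1 := by
  rw [Finset.prod_ite, Finset.prod_const, Finset.prod_const_one, mul_one]
  split_ifs with h
  · exact Odd.neg_one_pow h
  · exact (Nat.not_odd_iff_even.mp h).neg_one_pow

theorem sum_sign {n : ℕ} (i : Fin n) :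
    ∑ v, (if v = i then (-1 : ℝ) else 1) = n - 2 := by
  have h (v : Fin n) : (if v = i then (-1 : ℝ) else 1) = 1 - if v = i then 2 else 0 := by
    split_ifs <;> norm_num
  simp [h]

theorem sum_sign_mul_sign {n : ℕ} {i j : Fin n} (hij : i ≠ j) :
    ∑ v, (if v = i then (-1 : ℝ) else 1) * (if v = j then (-1 : ℝ) else 1) = n - 4 := by
  have h (v : Fin n) : (if v = i then (-1 : ℝ) else 1) * (if v = j then (-1 : ℝ) else 1) =
      1 - (if v = i then 2 else 0) - if v = j then 2 else 0 := by
    by_cases hi : v = i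
    · subst hi
      norm_num [hij]
    · split_ifs <;> norm_num
  simp only [h, Finset.sum_sub_distrib, Finset.sum_ite_eq', Finset.mem_univ, if_true]
  simp only [Finset.sum_const, Finset.card_univ, Fintype.card_fin, nsmul_eq_mul]
  ring

/-- The number of assignments leaving odd stacks on two distinct vertices. -/
theorem card_two_odd_stacks {n : ℕ} (t : ℕ) {i j : Fin n} (hij : i ≠ j) :
    ((Finset.univ.filter fun f : Fin t → Fin n => oddAt f i ∧ oddAt f j).card : ℝ) =
      (1 / 4) * ((n : ℝ) ^ t + ((n : ℝ) - 4) ^ t - 2 * ((n : ℝ) - 2) ^ t) := by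
  have h (f : Fin t → Fin n) : (if oddAt f i ∧ oddAt f j then (1 : ℝ) else 0) =
      (1 / 4) * (1 - ∏ p, (if f p = i then (-1 : ℝ) else 1)
        - ∏ p, (if f p = j then (-1 : ℝ) else 1)
        + ∏ p, (if f p = i then (-1 : ℝ) else 1) * (if f p = j then (-1 : ℝ) else 1)) := by
    rw [Finset.prod_mul_distrib, prod_sign_eq_ite_oddAt, prod_sign_eq_ite_oddAt]
    by_cases hi : oddAt f i <;> by_cases hj : oddAt f j <;> norm_num [hi, hj]
  have hpow (g : Fin n → ℝ) : ∑ f : Fin t → Fin n, ∏ p, g (f p) = (∑ v, g v) ^ t :=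
    (Fintype.sum_pow g t).symm
  rw [← Finset.sum_boole, Finset.sum_congr rfl fun f _ => h f, ← Finset.mul_sum,
    Finset.sum_add_distrib, Finset.sum_sub_distrib, Finset.sum_sub_distrib,
    hpow fun v => if v = i then (-1 : ℝ) else 1, hpow fun v => if v = j then (-1 : ℝ) else 1,
    hpow fun v => (if v = i then (-1 : ℝ) else 1) * (if v = j then (-1 : ℝ) else 1),
    sum_sign, sum_sign, sum_sign_mul_sign hij]
  simp only [Finset.sum_const, Finset.card_univ, Fintype.card_fun, Fintype.card_fin,
    nsmul_eq_mul, Nat.cast_pow]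
  ring

/-- When `t` pebbles are placed independently and uniformly at random on `n ≥ 2`
vertices (Maxwell Boltzmann scheme, all `n^t` assignments equally likely), the
probability that two fixed distinct vertices both receive an odd number of pebbles
equals `(1/4)·(1 + (1 − 4/n)^t − 2(1 − 2/n)^t)`. -/
theorem mb_prob_two_odd_stacks (n t : ℕ) (hn : 2 ≤ n) (i j : Fin n) (hij : i ≠ j) :
    ((Finset.univ.filter fun f : Fin t → Fin n => oddAt f i ∧ oddAt f j).card : ℝ)
        / (n : ℝ) ^ t
      = (1 / 4) * (1 + (1 - 4 / (n : ℝ)) ^ t - 2 * (1 - 2 / (n : ℝ)) ^ t) := by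
  have hn0 : (n : ℝ) ≠ 0 := by
    have : n ≠ 0 := by omega
    exact_mod_cast this
  rw [card_two_odd_stacks t hij, one_sub_div hn0, one_sub_div hn0, div_pow, div_pow]
  field_simp
end

section
/- When t pebbles are placed independently and uniformly at random on n ≥ 2 vertices (Maxwell Boltzmann scheme), the covariance of the indicators that two fixed distinct vertices receive an odd number of pebbles equals (1/4)·((1 − 4/n)^t − (1 − 2/n)^{2t}). -/
/-- The probability, under the Maxwell Boltzmann scheme (all `n^t` assignments of
`t` pebbles to `n` vertices equally likely), of the event described by `P`. -/
noncomputable def mbProb (n t : ℕ) (P : (Fin t → Fin n) → Prop) [DecidablePred P] : ℝ :=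
  ((Finset.univ.filter P).card : ℝ) / (n : ℝ) ^ t

/-- The sign recording the parity of the number of pebbles on `v`. -/
def paritySign {n t : ℕ} (f : Fin t → Fin n) (v : Fin n) : ℝ :=
  ∏ p, if f p = v then -1 else 1

theorem ite_oddAt_eq {n t : ℕ} (f : Fin t → Fin n) (v : Fin n) :
    (if oddAt f v then (1 : ℝ) else 0) = (1 - paritySign f v) / 2 := by
  have h : paritySign f v = (-1) ^ (Finset.univ.filter fun p : Fin t => f p = v).card := by
    simp [paritySign, Finset.prod_ite]
  rw [h]
  by_cases ho : oddAt f v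
  · rw [if_pos ho, Odd.neg_one_pow ho]
    norm_num
  · rw [if_neg ho, Even.neg_one_pow (Nat.not_odd_iff_even.mp ho)]
    norm_num

theorem sum_ite_neg_one {n : ℕ} (v : Fin n) :
    ∑ x : Fin n, (if x = v then (-1 : ℝ) else 1) = n - 2 := by
  have h : ∀ x : Fin n, (if x = v then (-1 : ℝ) else 1) = 1 - if x = v then 2 else 0 := by
    intro x
    split_ifs <;> norm_num
  simp [h]

theorem sum_ite_neg_one_mul {n : ℕ} {i j : Fin n} (hij : i ≠ j) :
    ∑ x : Fin n, (if x = i then (-1 : ℝ) else 1) * (if x = j then -1 else 1) = n - 4 := by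
  have h : ∀ x : Fin n, (if x = i then (-1 : ℝ) else 1) * (if x = j then -1 else 1) =
      1 - (if x = i then 2 else 0) - if x = j then 2 else 0 := by
    intro x
    split_ifs with h₁ h₂
    · exact absurd (h₁.symm.trans h₂) hij
    all_goals norm_num
  simp only [h, Finset.sum_sub_distrib]
  simp
  ring

theorem sum_paritySign {n : ℕ} (t : ℕ) (v : Fin n) :
    ∑ f : Fin t → Fin n, paritySign f v = ((n : ℝ) - 2) ^ t := by
  rw [← sum_ite_neg_one v, Fintype.sum_pow]
  rfl

theorem sum_paritySign_mul {n : ℕ} (t : ℕ) {i j : Fin n} (hij : i ≠ j) :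
    ∑ f : Fin t → Fin n, paritySign f i * paritySign f j = ((n : ℝ) - 4) ^ t := by
  rw [← sum_ite_neg_one_mul hij, Fintype.sum_pow]
  simp only [paritySign, Finset.prod_mul_distrib]

theorem mbProb_oddAt {n : ℕ} (t : ℕ) (v : Fin n) :
    mbProb n t (fun f => oddAt f v) = (((n : ℝ) ^ t - (n - 2) ^ t) / 2) / n ^ t := by
  rw [mbProb, Finset.card_filter, Nat.cast_sum]
  simp only [Nat.cast_ite, Nat.cast_one, Nat.cast_zero, ite_oddAt_eq]
  rw [← Finset.sum_div, Finset.sum_sub_distrib, sum_paritySign]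
  simp

theorem mbProb_oddAt_and {n : ℕ} (t : ℕ) {i j : Fin n} (hij : i ≠ j) :
    mbProb n t (fun f => oddAt f i ∧ oddAt f j) =
      (((n : ℝ) ^ t - 2 * (n - 2) ^ t + (n - 4) ^ t) / 4) / n ^ t := by
  have h : ∀ f : Fin t → Fin n, (if oddAt f i ∧ oddAt f j then (1 : ℝ) else 0) =
      (1 - paritySign f i - paritySign f j + paritySign f i * paritySign f j) / 4 := by
    intro f
    have hmul : (if oddAt f i ∧ oddAt f j then (1 : ℝ) else 0) =
        (if oddAt f i then 1 else 0) * if oddAt f j then 1 else 0 := by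
      by_cases hi : oddAt f i <;> simp [hi]
    rw [hmul, ite_oddAt_eq, ite_oddAt_eq]
    ring
  rw [mbProb, Finset.card_filter, Nat.cast_sum]
  simp only [Nat.cast_ite, Nat.cast_one, Nat.cast_zero, h]
  rw [← Finset.sum_div, Finset.sum_add_distrib, Finset.sum_sub_distrib, Finset.sum_sub_distrib,
    sum_paritySign, sum_paritySign, sum_paritySign_mul t hij]
  simp
  ring

/-- When `t` pebbles are placed independently and uniformly at random on `n ≥ 2`
vertices (Maxwell Boltzmann scheme), the covariance
`E(I_i I_j) − E(I_i)·E(I_j)` of the indicators that two fixed distinct vertices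
receive an odd number of pebbles equals `(1/4)·((1 − 4/n)^t − (1 − 2/n)^{2t})`. -/
theorem mb_cov_odd_stacks (n t : ℕ) (hn : 2 ≤ n) (i j : Fin n) (hij : i ≠ j) :
    mbProb n t (fun f => oddAt f i ∧ oddAt f j)
        - mbProb n t (fun f => oddAt f i) * mbProb n t (fun f => oddAt f j)
      = (1 / 4) * ((1 - 4 / (n : ℝ)) ^ t - (1 - 2 / (n : ℝ)) ^ (2 * t)) := by
  have hn₀ : (n : ℝ) ≠ 0 := by
    have : n ≠ 0 := by omega
    exact_mod_cast this
  have h₄ : 1 - 4 / (n : ℝ) = (n - 4) / n := by field_simp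
  have h₂ : 1 - 2 / (n : ℝ) = (n - 2) / n := by field_simp
  rw [mbProb_oddAt_and t hij, mbProb_oddAt, mbProb_oddAt, h₄, h₂, mul_comm 2 t, pow_mul,
    div_pow, div_pow]
  have hpow : (n : ℝ) ^ t ≠ 0 := pow_ne_zero t hn₀
  generalize (n : ℝ) ^ t = a at *
  generalize ((n : ℝ) - 2) ^ t = b
  generalize ((n : ℝ) - 4) ^ t = c
  field_simp
  ring
end

section
/- When t pebbles are placed independently and uniformly at random on n ≥ 2 vertices (Maxwell Boltzmann scheme), the variance of the number X of vertices receiving an odd number of pebbles equals (n/4)·(1 − (1 − 2/n)^{2t}) + (n(n−1)/4)·((1 − 4/n)^t − (1 − 2/n)^{2t}). -/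
/-- For an assignment `f` of `t` distinguishable pebbles to `n` vertices
(pebble `p` is placed on vertex `f p`), `mbOddStacks f` is the number of
vertices receiving an odd number of pebbles. -/
def mbOddStacks {n t : ℕ} (f : Fin t → Fin n) : ℕ :=
  (Finset.univ.filter fun v : Fin n =>
    Odd ((Finset.univ.filter fun p : Fin t => f p = v).card)).card

/-- The expectation, under the Maxwell Boltzmann scheme (all `n^t` assignments of
`t` pebbles to `n` vertices equally likely), of a real-valued function of the
assignment. -/
noncomputable def mbExp (n t : ℕ) (g : (Fin t → Fin n) → ℝ) : ℝ :=
  (∑ f : Fin t → Fin n, g f) / (n : ℝ) ^ t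

/-- The function on vertices that is `-1` at `v` and `1` elsewhere. -/
def vertexSign {n : ℕ} (v w : Fin n) : ℝ := if w = v then -1 else 1

theorem sum_vertexSign {n : ℕ} (v : Fin n) : ∑ w, vertexSign v w = (n : ℝ) - 2 := by
  have h (w : Fin n) : vertexSign v w = 1 - if w = v then 2 else 0 := by
    unfold vertexSign; split_ifs <;> norm_num
  simp [h, Finset.sum_sub_distrib]

theorem sum_vertexSign_mul_self {n : ℕ} (v : Fin n) :
    ∑ w, vertexSign v w * vertexSign v w = (n : ℝ) := by
  have h (w : Fin n) : vertexSign v w * vertexSign v w = 1 := by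
    unfold vertexSign; split_ifs <;> norm_num
  simp [h]

theorem sum_vertexSign_mul_of_ne {n : ℕ} {u v : Fin n} (huv : u ≠ v) :
    ∑ w, vertexSign u w * vertexSign v w = (n : ℝ) - 4 := by
  have h (w : Fin n) : vertexSign u w * vertexSign v w
      = 1 - (if w = u then 2 else 0) - if w = v then 2 else 0 := by
    unfold vertexSign
    split_ifs with hu hv
    · exact absurd (hu.symm.trans hv) huv
    all_goals norm_num
  simp only [h, Finset.sum_sub_distrib, Finset.sum_ite_eq', Finset.mem_univ, if_true,
    Finset.sum_const, Finset.card_univ, Fintype.card_fin, nsmul_eq_mul, mul_one]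
  ring

theorem prod_vertexSign {n t : ℕ} (f : Fin t → Fin n) (v : Fin n) :
    ∏ p, vertexSign v (f p) = (-1) ^ (Finset.univ.filter fun p => f p = v).card := by
  simp [vertexSign, Finset.prod_ite]

theorem mbOddStacks_eq {n t : ℕ} (f : Fin t → Fin n) :
    (mbOddStacks f : ℝ) = ((n : ℝ) - ∑ v, ∏ p, vertexSign v (f p)) / 2 := by
  have h (k : ℕ) : (if Odd k then (1 : ℝ) else 0) = (1 - (-1) ^ k) / 2 := by
    rcases Nat.even_or_odd k with hk | hk
    · simp [hk.neg_one_pow, Nat.not_odd_iff_even.mpr hk]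
    · rw [if_pos hk, hk.neg_one_pow]; norm_num
  rw [mbOddStacks, Finset.card_filter]
  push_cast
  simp only [h, prod_vertexSign]
  rw [← Finset.sum_div, Finset.sum_sub_distrib]
  simp

theorem sum_sum_prod_vertexSign (n t : ℕ) :
    ∑ f : Fin t → Fin n, ∑ v, ∏ p, vertexSign v (f p) = (n : ℝ) * ((n : ℝ) - 2) ^ t := by
  rw [Finset.sum_comm]
  simp [← Fintype.sum_pow, sum_vertexSign]

theorem sum_sq_sum_prod_vertexSign (n t : ℕ) :
    ∑ f : Fin t → Fin n, (∑ v, ∏ p, vertexSign v (f p)) ^ 2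
      = (n : ℝ) * (n : ℝ) ^ t + (n : ℝ) * ((n : ℝ) - 1) * ((n : ℝ) - 4) ^ t := by
  have h (u v : Fin n) : (∑ w, vertexSign u w * vertexSign v w) ^ t
      = ((n : ℝ) - 4) ^ t + if v = u then (n : ℝ) ^ t - ((n : ℝ) - 4) ^ t else 0 := by
    split_ifs with huv
    · rw [huv, sum_vertexSign_mul_self]; ring
    · rw [sum_vertexSign_mul_of_ne (Ne.symm huv), add_zero]
  simp only [sq, Finset.sum_mul_sum, ← Finset.prod_mul_distrib]
  rw [Finset.sum_comm]
  have key (u : Fin n) :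
      ∑ f : Fin t → Fin n, ∑ v, ∏ p, vertexSign u (f p) * vertexSign v (f p)
        = ∑ v, (∑ w, vertexSign u w * vertexSign v w) ^ t := by
    rw [Finset.sum_comm]
    exact Finset.sum_congr rfl fun v _ =>
      (Fintype.sum_pow (fun w => vertexSign u w * vertexSign v w) t).symm
  simp only [key, h]
  simp only [Finset.sum_add_distrib, Finset.sum_ite_eq', Finset.mem_univ, if_true,
    Finset.sum_const, Finset.card_univ, Fintype.card_fin, nsmul_eq_mul]
  ring


/-- When `t` pebbles are placed independently and uniformly at random on `n ≥ 2`
vertices (Maxwell Boltzmann scheme), the variance of the number `X` of vertices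
receiving an odd number of pebbles equals
`(n/4)·(1 − (1 − 2/n)^{2t}) + (n(n−1)/4)·((1 − 4/n)^t − (1 − 2/n)^{2t})`. -/
theorem mb_var_odd_stacks (n t : ℕ) (hn : 2 ≤ n) :
    mbExp n t (fun f => (mbOddStacks f : ℝ) ^ 2)
        - (mbExp n t (fun f => (mbOddStacks f : ℝ))) ^ 2
      = ((n : ℝ) / 4) * (1 - (1 - 2 / (n : ℝ)) ^ (2 * t))
        + ((n : ℝ) * ((n : ℝ) - 1) / 4)
          * ((1 - 4 / (n : ℝ)) ^ t - (1 - 2 / (n : ℝ)) ^ (2 * t)) := by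
  have hn0 : (n : ℝ) ≠ 0 := by positivity
  have hcard : ∑ _f : Fin t → Fin n, (1 : ℝ) = (n : ℝ) ^ t := by simp
  have h1 : ∑ f : Fin t → Fin n, (mbOddStacks f : ℝ)
      = ((n : ℝ) * (n : ℝ) ^ t - (n : ℝ) * ((n : ℝ) - 2) ^ t) / 2 := by
    simp only [mbOddStacks_eq]
    rw [← Finset.sum_div, Finset.sum_sub_distrib, sum_sum_prod_vertexSign, ← hcard,
      Finset.mul_sum, mul_one]
  have h2 : ∑ f : Fin t → Fin n, (mbOddStacks f : ℝ) ^ 2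
      = ((n : ℝ) ^ 2 * (n : ℝ) ^ t - 2 * (n : ℝ) * ((n : ℝ) * ((n : ℝ) - 2) ^ t)
        + ((n : ℝ) * (n : ℝ) ^ t + (n : ℝ) * ((n : ℝ) - 1) * ((n : ℝ) - 4) ^ t)) / 4 := by
    have h (x : ℝ) : (((n : ℝ) - x) / 2) ^ 2 = ((n : ℝ) ^ 2 * 1 - 2 * (n : ℝ) * x + x ^ 2) / 4 := by
      ring
    simp only [mbOddStacks_eq, h]
    rw [← Finset.sum_div, Finset.sum_add_distrib, Finset.sum_sub_distrib, ← Finset.mul_sum,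
      ← Finset.mul_sum, sum_sum_prod_vertexSign, sum_sq_sum_prod_vertexSign, hcard]
  have ha : 1 - 2 / (n : ℝ) = ((n : ℝ) - 2) / n := by field_simp
  have hb : 1 - 4 / (n : ℝ) = ((n : ℝ) - 4) / n := by field_simp
  rw [mbExp, mbExp, h1, h2, ha, hb, mul_comm 2 t, pow_mul]
  simp only [div_pow]
  have hnt : (n : ℝ) ^ t ≠ 0 := pow_ne_zero t hn0
  generalize (n : ℝ) ^ t = N at *
  generalize ((n : ℝ) - 2) ^ t = A
  generalize ((n : ℝ) - 4) ^ t = B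
  field_simp
  ring
end

section
/- Let A_0 be the unique positive real solution of A − (1/2)e^{−2A} = 3/2 (so A_0 = 1.5238...), and let φ : ℕ → ℝ be any function with φ(n) → ∞ as n → ∞. If t = t(n) is a sequence of integers with t(n) = A_0·n + φ(n)·√n (up to rounding), and t(n) pebbles are placed independently and uniformly at random on the n vertices of the complete graph K_n, then the probability that the resulting configuration is cover solvable tends to 1 as n → ∞. -/
/-- The configuration on `n` vertices induced by an assignment `f` of `t`
distinguishable pebbles to vertices: vertex `v` gets `#{p | f p = v}` pebbles. -/
def mbConfig {n t : ℕ} (f : Fin t → Fin n) : Fin n → ℕ :=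
  fun v => (Finset.univ.filter fun p : Fin t => f p = v).card

/-- The probability, when `t` distinguishable pebbles are placed independently and
uniformly at random on the `n` vertices of the complete graph `K_n` (Maxwell
Boltzmann scheme, all `n^t` assignments equally likely), that the resulting
configuration is cover solvable. -/
noncomputable def mbCoverProb (n t : ℕ) : ℝ :=
  (Nat.card {f : Fin t → Fin n //
      CoverSolvable (⊤ : SimpleGraph (Fin n)) (mbConfig f)} : ℝ) / (n : ℝ) ^ t

open Finset in
/-- On a complete graph, a configuration is cover solvable as soon as the total number of pebbles
is at least the number of vertices plus the number of vertices carrying an even number of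
pebbles. -/
theorem coverSolvable_top_of_sum_nonneg {V : Type*} [Fintype V] [DecidableEq V] (C : V → ℕ)
    (h : 0 ≤ ∑ v, (2 * (C v : ℤ) - 3 - (-1) ^ C v)) :
    CoverSolvable (⊤ : SimpleGraph V) C := by
  induction hk : #{v | C v = 0} using Nat.strong_induction_on generalizing C with
  | _ k ih =>
  by_cases hall : ∀ v, 1 ≤ C v
  · exact ⟨C, .refl, hall⟩
  push Not at hall
  obtain ⟨v, hv⟩ := hall
  replace hv : C v = 0 := by omega
  obtain ⟨u, hu⟩ : ∃ u, 3 ≤ C u := by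
    by_contra! hlt
    have hneg : ∑ x, (2 * (C x : ℤ) - 3 - (-1) ^ C x) < ∑ _x : V, 0 := by
      refine sum_lt_sum (fun x _ => ?_) ⟨v, mem_univ v, by simp [hv]⟩
      have hx := hlt x
      interval_cases C x <;> norm_num
    simp only [sum_const_zero] at hneg
    omega
  have huv : u ≠ v := by rintro rfl; omega
  set C' := Function.update (Function.update C u (C u - 2)) v (C v + 1) with hC'
  have hC'v : C' v = 1 := by simp [hC', hv]
  have hC'u : C' u = C u - 2 := by simp [hC', huv]
  have hC'x : ∀ x, x ≠ u → x ≠ v → C' x = C x := fun x h1 h2 => by simp [hC', h1, h2]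
  have hsum : ∑ x, (2 * (C' x : ℤ) - 3 - (-1) ^ C' x) =
      ∑ x, (2 * (C x : ℤ) - 3 - (-1) ^ C x) := by
    have hpt : ∀ x, (2 * (C' x : ℤ) - 3 - (-1) ^ C' x) =
        (2 * (C x : ℤ) - 3 - (-1) ^ C x) + (if x = v then 4 else 0)
          - (if x = u then 4 else 0) := by
      intro x
      by_cases hxv : x = v
      · subst hxv; simp [hC'v, hv, huv.symm]
      by_cases hxu : x = u
      · subst hxu
        obtain ⟨c, hc⟩ := Nat.exists_eq_add_of_le hu
        have hc' : C' x = c + 1 := by omega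
        simp only [hc', hc, hxv, if_true, if_false]
        push_cast
        ring
      · simp [hC'x x hxu hxv, hxu, hxv]
    simp only [hpt, sum_sub_distrib, sum_add_distrib, sum_ite_eq', mem_univ, if_true]
    ring
  have hcard : #{x | C' x = 0} < k := by
    rw [← hk]
    refine card_lt_card ⟨fun x hx => ?_, fun hsub => ?_⟩
    · simp only [mem_filter, mem_univ, true_and] at hx ⊢
      have hxv : x ≠ v := by rintro rfl; omega
      have hxu : x ≠ u := by rintro rfl; omega
      rwa [← hC'x x hxu hxv]
    · have hmem := hsub (show v ∈ ({x | C x = 0} : Finset V) by simp [hv])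
      simp [hC'v] at hmem
  obtain ⟨D, hD, hD1⟩ := ih _ hcard C' (hsum ▸ h) rfl
  exact ⟨D, .head ⟨u, v, by simpa using huv, by omega, rfl⟩ hD, hD1⟩

theorem sum_mbConfig {n t : ℕ} (f : Fin t → Fin n) : ∑ v, mbConfig f v = t := by
  simpa [mbConfig] using
    (Finset.card_eq_sum_card_fiberwise (s := Finset.univ) (t := Finset.univ) (f := f)
      (by simp)).symm

theorem neg_one_pow_mbConfig {n t : ℕ} (f : Fin t → Fin n) (v : Fin n) :
    (-1 : ℝ) ^ mbConfig f v = ∏ p, if f p = v then (-1 : ℝ) else 1 := by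
  simp [mbConfig, Finset.prod_ite]

theorem sum_neg_one_pow_mbConfig {n : ℕ} (t : ℕ) (v : Fin n) :
    ∑ f : Fin t → Fin n, (-1 : ℝ) ^ mbConfig f v = ((n : ℝ) - 2) ^ t := by
  have hx : ∀ x : Fin n, (if x = v then (-1 : ℝ) else 1) = 1 - if x = v then 2 else 0 := by
    intro x; split_ifs <;> norm_num
  simp only [neg_one_pow_mbConfig]
  rw [← Fintype.sum_pow (fun x : Fin n => if x = v then (-1 : ℝ) else 1) t]
  simp [hx]

theorem sum_neg_one_pow_mbConfig_mul {n : ℕ} (t : ℕ) {v w : Fin n} (hvw : v ≠ w) :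
    ∑ f : Fin t → Fin n, (-1 : ℝ) ^ mbConfig f v * (-1 : ℝ) ^ mbConfig f w =
      ((n : ℝ) - 4) ^ t := by
  have hx : ∀ x : Fin n, (if x = v then (-1 : ℝ) else 1) * (if x = w then (-1 : ℝ) else 1) =
      1 - (if x = v then 2 else 0) - if x = w then 2 else 0 := by
    intro x
    by_cases h1 : x = v
    · subst h1; norm_num [hvw]
    · by_cases h2 : x = w
      · subst h2; norm_num [h1]
      · norm_num [h1, h2]
  simp only [neg_one_pow_mbConfig, ← Finset.prod_mul_distrib]
  rw [← Fintype.sum_pow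
    (fun x : Fin n => (if x = v then (-1 : ℝ) else 1) * (if x = w then (-1 : ℝ) else 1)) t]
  simp only [hx, Finset.sum_sub_distrib, Finset.sum_ite_eq', Finset.mem_univ, if_true]
  simp only [Finset.sum_const, Finset.card_univ, Fintype.card_fin, nsmul_eq_mul, mul_one]
  ring

theorem sum_sq_sum_neg_one_pow_mbConfig (n t : ℕ) :
    ∑ f : Fin t → Fin n, (∑ v, (-1 : ℝ) ^ mbConfig f v) ^ 2 =
      n * (n : ℝ) ^ t + n * ((n : ℝ) - 1) * ((n : ℝ) - 4) ^ t := by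
  have hvw : ∀ v w : Fin n,
      ∑ f : Fin t → Fin n, (-1 : ℝ) ^ mbConfig f v * (-1 : ℝ) ^ mbConfig f w =
        ((n : ℝ) - 4) ^ t + if v = w then (n : ℝ) ^ t - ((n : ℝ) - 4) ^ t else 0 := by
    intro v w
    split_ifs with h
    · subst h
      simp [← mul_pow]
    · simp [sum_neg_one_pow_mbConfig_mul t h]
  simp only [sq, Finset.sum_mul_sum]
  rw [Finset.sum_comm]
  simp only [Finset.sum_comm (s := (Finset.univ : Finset (Fin t → Fin n)))]
  simp only [hvw, Finset.sum_add_distrib, Finset.sum_ite_eq, Finset.mem_univ, if_true,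
    Finset.sum_const, Finset.card_univ, Fintype.card_fin, nsmul_eq_mul]
  ring

/-- The number of vertices with an even number of pebbles minus the number of those with an odd
number has variance at most `n`. -/
theorem sum_sq_sum_neg_one_pow_mbConfig_sub_le {n : ℕ} (hn : 4 ≤ n) (t : ℕ) :
    ∑ f : Fin t → Fin n, (∑ v, (-1 : ℝ) ^ mbConfig f v - n * (1 - 2 / n) ^ t) ^ 2 ≤
      n * (n : ℝ) ^ t := by
  have hn4 : (4 : ℝ) ≤ n := by exact_mod_cast hn
  have hn0 : (0 : ℝ) < n := by linarith
  have h1 : ∑ f : Fin t → Fin n, ∑ v, (-1 : ℝ) ^ mbConfig f v =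
      n * ((1 - 2 / n) ^ t * (n : ℝ) ^ t) := by
    rw [Finset.sum_comm]
    simp only [sum_neg_one_pow_mbConfig, Finset.sum_const, Finset.card_univ, Fintype.card_fin,
      nsmul_eq_mul]
    rw [← mul_pow]
    congr 2
    field_simp
  have h2 : ((n : ℝ) - 4) ^ t ≤ (1 - 2 / n) ^ t * (1 - 2 / n) ^ t * (n : ℝ) ^ t := by
    rw [← mul_pow, ← mul_pow]
    refine pow_le_pow_left₀ (by linarith) ?_ t
    have : (1 - 2 / (n : ℝ)) * (1 - 2 / n) * n = n - 4 + 4 / n := by field_simp; ring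
    rw [this]
    have : 0 ≤ 4 / (n : ℝ) := by positivity
    linarith
  have h3 : 0 ≤ ((n : ℝ) - 4) ^ t := pow_nonneg (by linarith) t
  simp only [sub_sq, Finset.sum_add_distrib, Finset.sum_sub_distrib, ← Finset.sum_mul,
    ← Finset.mul_sum, sum_sq_sum_neg_one_pow_mbConfig, h1]
  simp only [Finset.sum_const, Finset.card_univ, Fintype.card_fun, Fintype.card_fin,
    nsmul_eq_mul, Nat.cast_pow]
  have h4 := mul_le_mul_of_nonneg_left h2 (sq_nonneg (n : ℝ))
  have h5 := mul_nonneg hn0.le h3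
  linear_combination h4 + h5

theorem mbCoverProb_le_one (n t : ℕ) : mbCoverProb n t ≤ 1 := by
  refine div_le_one_of_le₀ ?_ (by positivity)
  have h := Finite.card_subtype_le
    (fun f : Fin t → Fin n => CoverSolvable (⊤ : SimpleGraph (Fin n)) (mbConfig f))
  rw [Nat.card_fun, Nat.card_fin, Nat.card_fin] at h
  exact_mod_cast h

open Classical in
/-- Chebyshev's inequality for the failure of cover solvability. -/
theorem one_sub_div_sq_le_mbCoverProb {n t : ℕ} (hn : 4 ≤ n) {d : ℝ} (hd : 0 < d)
    (h : n * (1 - 2 / (n : ℝ)) ^ t + d ≤ 2 * t - 3 * n) :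
    1 - n / d ^ 2 ≤ mbCoverProb n t := by
  have hn0 : (0 : ℝ) < n := by exact_mod_cast (by omega : 0 < n)
  set P : (Fin t → Fin n) → Prop :=
    fun f => CoverSolvable (⊤ : SimpleGraph (Fin n)) (mbConfig f)
  have hbad : ∀ f, ¬ P f →
      d ^ 2 ≤ (∑ v, (-1 : ℝ) ^ mbConfig f v - n * (1 - 2 / n) ^ t) ^ 2 := by
    intro f hf
    have hlt : ∑ v, (2 * (mbConfig f v : ℤ) - 3 - (-1) ^ mbConfig f v) < 0 := by
      by_contra! hge
      exact hf (coverSolvable_top_of_sum_nonneg _ hge)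
    have hlt' : ∑ v, (2 * (mbConfig f v : ℝ) - 3 - (-1) ^ mbConfig f v) < 0 := by
      exact_mod_cast hlt
    have hs : ∑ v, (mbConfig f v : ℝ) = t := by exact_mod_cast sum_mbConfig f
    simp only [Finset.sum_sub_distrib, ← Finset.mul_sum, hs, Finset.sum_const,
      Finset.card_univ, Fintype.card_fin, nsmul_eq_mul] at hlt'
    exact pow_le_pow_left₀ hd.le (by linarith) 2
  have hcheb : ((Finset.univ.filter fun f => ¬ P f).card : ℝ) * d ^ 2 ≤ n * (n : ℝ) ^ t := by
    refine le_trans ?_ (sum_sq_sum_neg_one_pow_mbConfig_sub_le hn t)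
    rw [← nsmul_eq_mul]
    refine (Finset.card_nsmul_le_sum _ _ _ fun f hf => hbad f (by simpa using hf)).trans ?_
    exact Finset.sum_le_univ_sum_of_nonneg fun f => sq_nonneg _
  have hsplit : ((Finset.univ.filter P).card : ℝ) + (Finset.univ.filter fun f => ¬ P f).card =
      (n : ℝ) ^ t := by
    have := Finset.card_filter_add_card_filter_not (s := Finset.univ) P
    simp only [Finset.card_univ, Fintype.card_fun, Fintype.card_fin] at this
    exact_mod_cast this
  have hcard : Nat.card {f // P f} = (Finset.univ.filter P).card := by
    rw [Nat.card_eq_fintype_card, Fintype.card_subtype]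
  change _ ≤ (Nat.card {f // P f} : ℝ) / (n : ℝ) ^ t
  rw [hcard, le_div_iff₀ (by positivity), sub_mul, div_mul_eq_mul_div]
  have := (le_div_iff₀ (by positivity)).2 hcheb
  linarith

/-- Let `A₀` be the unique positive solution of `A − (1/2)e^{−2A} = 3/2` and let
`φ(n) → ∞`.  If `t(n) = A₀·n + φ(n)·√n` (up to rounding), then the probability
that `t(n)` pebbles placed uniformly at random on `K_n` (Maxwell Boltzmann
scheme) form a cover solvable configuration tends to `1`. -/
theorem mb_cover_threshold_upper (A0 : ℝ) (hA0pos : 0 < A0)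
    (hA0 : A0 - (1 / 2) * Real.exp (-2 * A0) = 3 / 2)
    (φ : ℕ → ℝ) (hφ : Filter.Tendsto φ Filter.atTop Filter.atTop)
    (t : ℕ → ℕ) (ht : ∀ n, |(t n : ℝ) - (A0 * n + φ n * Real.sqrt n)| ≤ 1) :
    Filter.Tendsto (fun n => mbCoverProb n (t n)) Filter.atTop (nhds 1) := by
  have hlim : Filter.Tendsto (fun n => 1 - (φ n ^ 2)⁻¹) Filter.atTop (nhds 1) := by
    simpa using tendsto_const_nhds.sub
      ((Filter.tendsto_pow_atTop two_ne_zero).comp hφ).inv_tendsto_atTop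
  refine tendsto_of_tendsto_of_tendsto_of_le_of_le' hlim tendsto_const_nhds ?_
    (.of_forall fun n => mbCoverProb_le_one n (t n))
  filter_upwards [hφ.eventually_ge_atTop 2, Filter.eventually_ge_atTop 4] with n hφn hn
  have hn4 : (4 : ℝ) ≤ n := by exact_mod_cast hn
  have hn0 : (0 : ℝ) < n := by linarith
  have hsqrt : 1 ≤ √(n : ℝ) := Real.one_le_sqrt.2 (by linarith)
  have hprod : 2 ≤ φ n * √(n : ℝ) := by nlinarith
  have htn := (abs_le.1 (ht n)).1
  have hmean : (1 - 2 / (n : ℝ)) ^ t n ≤ Real.exp (-2 * A0) := by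
    have h0 : 0 ≤ 1 - 2 / (n : ℝ) := by
      rw [sub_nonneg, div_le_one hn0]; linarith
    calc (1 - 2 / (n : ℝ)) ^ t n ≤ Real.exp (-(2 / n)) ^ t n :=
          pow_le_pow_left₀ h0 (Real.one_sub_le_exp_neg _) _
      _ = Real.exp (t n * -(2 / n)) := (Real.exp_nat_mul _ _).symm
      _ ≤ Real.exp (-2 * A0) := by
          refine Real.exp_le_exp.2 ?_
          have : A0 ≤ t n / n := by rw [le_div_iff₀ hn0]; linarith
          have h2 : (t n : ℝ) * -(2 / n) = -2 * (t n / n) := by ring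
          linarith
  have hmain := one_sub_div_sq_le_mbCoverProb (t := t n) hn (d := φ n * √(n : ℝ))
    (by linarith) (by
      have h1 := mul_le_mul_of_nonneg_left hmean hn0.le
      have h2 : (n : ℝ) * Real.exp (-2 * A0) = 2 * (A0 * n) - 3 * n := by
        linear_combination (-2 * (n : ℝ)) * hA0
      linarith)
  have hφ0 : φ n ≠ 0 := by linarith
  rwa [mul_pow, Real.sq_sqrt hn0.le, div_mul_cancel_right₀ hn0.ne'] at hmain
end

section
/- Fix n ≥ 1 and t ≥ 0, and suppose a configuration of weight t on the n vertices of K_n is chosen uniformly at random from all C(n+t−1, n−1) configurations (Bose Einstein scheme). If x is a nonnegative integer with the same parity as t and x ≤ min(t, n), then the probability that exactly x vertices carry an odd number of pebbles equals C(n, x) · C((t−x)/2 + n − 1, n − 1) / C(n+t−1, n−1). -/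
/-- The configurations of weight `t` on `n` vertices: functions `C : Fin n → ℕ`
with `∑ v, C v = t`. -/
def configs (n t : ℕ) : Finset (Fin n → ℕ) := Finset.Nat.antidiagonalTuple n t

/-- The number of vertices carrying an odd number of pebbles ("odd stacks"). -/
def oddStacks {n : ℕ} (C : Fin n → ℕ) : ℕ :=
  (Finset.univ.filter fun v => Odd (C v)).card

theorem mem_configs {n t : ℕ} {C : Fin n → ℕ} : C ∈ configs n t ↔ ∑ v, C v = t :=
  Finset.Nat.mem_antidiagonalTuple

theorem card_configs (n t : ℕ) : (configs n t).card = (n + t - 1).choose t := by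
  rw [← Fintype.card_fin n, ← Sym.card_sym_eq_choose (α := Fin n), Fintype.card_fin,
    ← Finset.card_univ, configs, ← Finset.piAntidiag_univ_fin_eq_antidiagonalTuple,
    ← Finset.map_sym_eq_piAntidiag, Finset.card_map, Finset.sym_univ]

theorem oddStacks_eq_sum_mod_two {n : ℕ} (C : Fin n → ℕ) : oddStacks C = ∑ v, C v % 2 := by
  rw [oddStacks, Finset.card_filter]
  refine Finset.sum_congr rfl fun v _ => ?_
  split_ifs with h <;> grind

/-- A configuration is determined by its set of odd stacks and the halves of its stacks,
rounded down. -/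
theorem card_filter_oddStacks_eq {n t x : ℕ} (hpar : x % 2 = t % 2) (hxt : x ≤ t) :
    ((configs n t).filter fun C => oddStacks C = x).card =
      n.choose x * (configs n ((t - x) / 2)).card := by
  have hcard : n.choose x = ((Finset.univ : Finset (Fin n)).powersetCard x).card := by simp
  rw [hcard, ← Finset.card_product]
  refine Finset.card_nbij' (fun C => (Finset.univ.filter fun v => Odd (C v), fun v => C v / 2))
    (fun p v => 2 * p.2 v + if v ∈ p.1 then 1 else 0) ?_ ?_ ?_ ?_
  · intro C hC
    simp only [Finset.mem_coe, Finset.mem_filter, mem_configs] at hC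
    have hodd := oddStacks_eq_sum_mod_two C
    have hsum : 2 * ∑ v, C v / 2 + ∑ v, C v % 2 = ∑ v, C v := by
      rw [Finset.mul_sum, ← Finset.sum_add_distrib]
      exact Finset.sum_congr rfl fun v _ => Nat.div_add_mod (C v) 2
    simp only [Finset.coe_product, Set.mem_prod, Finset.mem_coe, Finset.mem_powersetCard_univ,
      mem_configs]
    exact ⟨hC.2, by omega⟩
  · rintro ⟨S, D⟩ h
    simp only [Finset.coe_product, Set.mem_prod, Finset.mem_coe, Finset.mem_powersetCard_univ,
      mem_configs] at h
    rw [Finset.mem_coe, Finset.mem_filter, mem_configs, oddStacks]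
    constructor
    · rw [Finset.sum_add_distrib, ← Finset.mul_sum, h.2]
      simp only [Finset.sum_boole, Finset.filter_univ_mem, h.1, Nat.cast_id]
      omega
    · rw [← h.1]
      congr 1
      ext v
      by_cases hv : v ∈ S <;> simp [hv]
  · intro C _
    funext v
    simp only [Finset.mem_filter, Finset.mem_univ, true_and]
    split_ifs with h <;> grind
  · rintro ⟨S, D⟩ _
    ext v
    · by_cases hv : v ∈ S <;> simp [hv]
    · by_cases hv : v ∈ S <;> simp [hv]
      omega

/-- Fix `n ≥ 1` and `t ≥ 0`, and choose a configuration of weight `t` on the `n`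
vertices of `K_n` uniformly at random among all `C(n+t−1, n−1)` configurations
(Bose Einstein scheme).  If `x` has the same parity as `t` and `x ≤ min(t,n)`,
then the probability that exactly `x` vertices carry an odd number of pebbles is
`C(n,x)·C((t−x)/2 + n − 1, n − 1) / C(n+t−1, n−1)`. -/
theorem be_prob_odd_stacks_eq (n t x : ℕ) (hn : 1 ≤ n)
    (hpar : x % 2 = t % 2) (hxt : x ≤ t) (hxn : x ≤ n) :
    ((((configs n t).filter fun C => oddStacks C = x).card : ℝ)
        / ((n + t - 1).choose (n - 1) : ℝ))
      = ((n.choose x * ((t - x) / 2 + n - 1).choose (n - 1) : ℕ) : ℝ)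
          / ((n + t - 1).choose (n - 1) : ℝ) := by
  have hchoose : (n + (t - x) / 2 - 1).choose ((t - x) / 2) =
      ((t - x) / 2 + n - 1).choose (n - 1) := by
    rw [add_comm n]
    exact Nat.choose_symm_of_eq_add (by omega)
  rw [card_filter_oddStacks_eq hpar hxt, card_configs, hchoose]
end

section
/- Let γ = (1+√5)/2 be the golden ratio, and let φ : ℕ → ℝ be any function with φ(n) → ∞ as n → ∞. If t = t(n) is a sequence of integers with t(n) = γ·n + φ(n)·√n (up to rounding), and a configuration of t(n) pebbles on the vertices of the complete graph K_n is chosen uniformly at random from all C(n+t−1, n−1) configurations of weight t(n) (Bose Einstein scheme), then the probability that the configuration is cover solvable tends to 1 as n → ∞. -/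
/-- The probability, when a configuration of weight `t` on the `n` vertices of the
complete graph `K_n` is chosen uniformly at random among all `C(n+t−1, n−1)`
configurations (Bose Einstein scheme), that the configuration is cover solvable. -/
noncomputable def beCoverProb (n t : ℕ) : ℝ :=
  (Nat.card {C : Fin n → ℕ // (∑ v, C v) = t ∧
      CoverSolvable (⊤ : SimpleGraph (Fin n)) C} : ℝ)
    / ((n + t - 1).choose (n - 1) : ℝ)

open Finset

/-- On a complete graph a configuration is cover solvable as soon as its weight is at least the
number of vertices plus the number of vertices carrying an even number of pebbles. -/
theorem coverSolvable_top_of_card_even_add_card_le {V : Type*} [Fintype V] [DecidableEq V]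
    (C : V → ℕ) (h : #{v | Even (C v)} + Fintype.card V ≤ ∑ v, C v) :
    CoverSolvable (⊤ : SimpleGraph V) C := by
  induction hk : #{v | Even (C v)} using Nat.strong_induction_on generalizing C with
  | _ k ih =>
    subst hk
    by_cases hpos : ∀ v, 1 ≤ C v
    · exact ⟨C, .refl, hpos⟩
    push Not at hpos
    obtain ⟨v, hv⟩ := hpos
    have hv0 : C v = 0 := by omega
    obtain ⟨u, hu⟩ : ∃ u, 3 ≤ C u := by
      by_contra! hsmall
      have : ∑ w, C w < ∑ w, ((if Even (C w) then 1 else 0) + 1) := by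
        refine sum_lt_sum (fun w _ => ?_) ⟨v, mem_univ v, by simp [hv0]⟩
        have := hsmall w
        interval_cases C w <;> simp
      rw [sum_add_distrib, ← card_filter] at this
      simp only [sum_const, card_univ, smul_eq_mul, mul_one] at this
      omega
    have huv : u ≠ v := by rintro rfl; omega
    set C' := Function.update (Function.update C u (C u - 2)) v (C v + 1) with hC'
    have hC'v : C' v = 1 := by simp [hC', hv0]
    have hC'u : C' u = C u - 2 := by simp [hC', huv]
    have hC'w : ∀ w, w ≠ u → w ≠ v → C' w = C w := by
      intro w h1 h2; simp [hC', h1, h2]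
    have hmove : PebblingMove ⊤ C C' := ⟨u, v, by simpa using huv, by omega, rfl⟩
    have heven : ({w | Even (C w)} : Finset V) = insert v ({w | Even (C' w)} : Finset V) := by
      ext w
      simp only [mem_filter, mem_univ, true_and, mem_insert]
      by_cases h1 : w = v
      · simp [h1, hv0]
      by_cases h2 : w = u
      · subst h2
        rw [hC'u, Nat.even_sub (by omega)]
        simp [h1]
      · simp [h1, hC'w w h2 h1]
    have hcard : #{w | Even (C w)} = #{w | Even (C' w)} + 1 := by
      rw [heven, card_insert_of_notMem (by simp [hC'v])]
    have hsum : ∑ w, C w = ∑ w, C' w + 1 := by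
      have hrest : ∑ w ∈ (univ.erase u).erase v, C w = ∑ w ∈ (univ.erase u).erase v, C' w :=
        sum_congr rfl fun w hw => by
          simp only [mem_erase, mem_univ, and_true] at hw
          exact (hC'w w hw.2 hw.1).symm
      rw [← add_sum_erase _ C (mem_univ u), ← add_sum_erase _ C' (mem_univ u),
        ← add_sum_erase _ C (mem_erase.2 ⟨huv.symm, mem_univ v⟩),
        ← add_sum_erase _ C' (mem_erase.2 ⟨huv.symm, mem_univ v⟩)]
      omega
    obtain ⟨D, hD, hD1⟩ := ih _ (by omega) C' (by omega) rfl
    exact ⟨D, .head hmove hD, hD1⟩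

/-- The sum of `∏ i, f i (C i)` over the configurations `C` of weight `t`, where `f i = 1` for `m`
of the indices and `f i j = (-1) ^ j` for `k` of them. -/
noncomputable def signedCount (m k t : ℕ) : ℝ :=
  PowerSeries.coeff t
    ((PowerSeries.mk 1 : PowerSeries ℝ) ^ m * (PowerSeries.mk fun j => (-1 : ℝ) ^ j) ^ k)

theorem sum_piAntidiag_prod_neg_one_pow {n : ℕ} (S : Finset (Fin n)) (t : ℕ) :
    ∑ C ∈ piAntidiag univ t, ∏ i ∈ S, (-1 : ℝ) ^ C i = signedCount (n - #S) #S t := by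
  have h : ((PowerSeries.mk 1 : PowerSeries ℝ) ^ (n - #S) *
      (PowerSeries.mk fun j => (-1 : ℝ) ^ j) ^ #S) =
      ∏ i : Fin n, if i ∈ S then (PowerSeries.mk fun j => (-1 : ℝ) ^ j) else PowerSeries.mk 1 := by
    rw [prod_ite, prod_const, prod_const, mul_comm]
    congr 2
    · simp
    · rw [filter_not, card_sdiff_of_subset (filter_subset _ _)]
      simp
  rw [signedCount, h, PowerSeries.coeff_prod]
  symm
  refine sum_bij (fun l _ => ⇑l) (fun l hl => ?_) (fun _ _ _ _ h => DFunLike.coe_injective h)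
    (fun C hC => ⟨Finsupp.equivFunOnFinite.symm C, ?_, rfl⟩) (fun l _ => ?_)
  · simpa using (mem_finsuppAntidiag.1 hl).1
  · simpa using (mem_piAntidiag.1 hC).1
  · rw [← prod_filter_mul_prod_filter_not univ (· ∈ S), filter_mem_eq_inter, univ_inter,
      prod_congr rfl (g := fun i => (-1 : ℝ) ^ l i) fun i hi => by simp [hi],
      prod_eq_one (s := univ.filter (· ∉ S)) fun i hi => by
        simp [(mem_filter.1 hi).2], mul_one]

theorem signedCount_zero (m k : ℕ) : signedCount m k 0 = 1 := by
  simp [signedCount]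

theorem signedCount_succ_left (m k t : ℕ) :
    signedCount (m + 1) k (t + 1) = signedCount (m + 1) k t + signedCount m k (t + 1) := by
  have h : (PowerSeries.mk 1 : PowerSeries ℝ) * (1 - PowerSeries.X) = 1 :=
    PowerSeries.mk_one_mul_one_sub_eq_one ℝ
  rw [← sub_eq_iff_eq_add']
  simp only [signedCount]
  rw [← PowerSeries.coeff_succ_mul_X t, ← map_sub]
  congr 1
  linear_combination (PowerSeries.mk 1 : PowerSeries ℝ) ^ m *
    (PowerSeries.mk fun j => (-1 : ℝ) ^ j) ^ k * h

theorem signedCount_succ_right (m k t : ℕ) :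
    signedCount m (k + 1) (t + 1) = signedCount m k (t + 1) - signedCount m (k + 1) t := by
  have h : (PowerSeries.mk fun j => (-1 : ℝ) ^ j) * (1 + PowerSeries.X) = 1 := by
    ext j
    cases j with
    | zero => simp [mul_add]
    | succ j => simp [mul_add, PowerSeries.coeff_succ_mul_X, pow_succ, PowerSeries.coeff_one]
  rw [eq_sub_iff_add_eq]
  simp only [signedCount]
  rw [← PowerSeries.coeff_succ_mul_X t, ← map_add]
  congr 1
  linear_combination (PowerSeries.mk 1 : PowerSeries ℝ) ^ m *
    (PowerSeries.mk fun j => (-1 : ℝ) ^ j) ^ k * h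

theorem signedCount_eq_choose (m t : ℕ) : signedCount (m + 1) 0 t = (m + t).choose m := by
  simp [signedCount, PowerSeries.mk_one_pow_eq_mk_choose_add]

theorem signedCount_pos (m t : ℕ) : 0 < signedCount (m + 1) 0 t := by
  rw [signedCount_eq_choose]
  exact_mod_cast Nat.choose_pos (by omega)

theorem succ_mul_signedCount_succ (m t : ℕ) :
    (t + 1 : ℝ) * signedCount (m + 1) 0 (t + 1) = (m + t + 1) * signedCount (m + 1) 0 t := by
  simp only [signedCount_eq_choose]
  have h := Nat.add_one_mul_choose_eq (m + t) t
  rw [Nat.choose_symm_add, Nat.choose_symm_add, mul_comm]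
  exact_mod_cast h.symm

theorem add_mul_signedCount (m t : ℕ) :
    (m + t + 1 : ℝ) * signedCount m 0 (t + 1) = m * signedCount (m + 1) 0 (t + 1) := by
  have h1 := signedCount_succ_left m 0 t
  have h2 := succ_mul_signedCount_succ m t
  linear_combination h2 - (m + t + 1 : ℝ) * h1

theorem abs_sub_div_le_of_recurrence {M : ℝ} (hM : 0 < M) {ρ : ℕ → ℝ} (h0 : ρ 0 = 1)
    (hrec : ∀ s : ℕ, (M + s + 1) * ρ (s + 1) = M - (s + 1) * ρ s) (s : ℕ) :
    |ρ s - M / (M + 2 * s)| ≤ 2 * s / M ^ 2 := by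
  induction s with
  | zero => simp [h0, hM.ne']
  | succ s ih =>
    have hs : (0 : ℝ) ≤ s := s.cast_nonneg
    have hg : 0 ≤ M / (M + 2 * s) - M / (M + 2 * (s + 1)) ∧
        M / (M + 2 * s) - M / (M + 2 * (s + 1)) ≤ 2 / M := by
      rw [div_sub_div _ _ (by positivity) (by positivity)]
      refine ⟨div_nonneg (by nlinarith) (by positivity), ?_⟩
      rw [div_le_div_iff₀ (by positivity) (by positivity)]
      nlinarith [mul_nonneg hM.le hs, mul_nonneg hs hs]
    have key : (M + s + 1) * (ρ (s + 1) - M / (M + 2 * (s + 1))) =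
        -(s + 1) * ((ρ s - M / (M + 2 * s)) + (M / (M + 2 * s) - M / (M + 2 * (s + 1)))) := by
      have : (M + s + 1) * (M / (M + 2 * (s + 1))) = M - (s + 1) * (M / (M + 2 * (s + 1))) := by
        field_simp; ring
      linear_combination hrec s - this
    have h2 : (M + s + 1) * |ρ (s + 1) - M / (M + 2 * (s + 1))| ≤
        (s + 1) * (2 * s / M ^ 2 + 2 / M) := by
      rw [← abs_of_pos (show 0 < M + s + 1 by positivity), ← abs_mul, key, abs_mul, abs_neg,
        abs_of_pos (show (0 : ℝ) < s + 1 by positivity)]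
      gcongr
      refine (abs_add_le _ _).trans (add_le_add ih ?_)
      rw [abs_of_nonneg hg.1]
      exact hg.2
    push_cast
    refine le_of_mul_le_mul_left (h2.trans ?_) (show 0 < M + s + 1 by positivity)
    rw [← sub_nonneg]
    have : (M + s + 1) * (2 * (s + 1) / M ^ 2) - (s + 1) * (2 * s / M ^ 2 + 2 / M) =
        (2 * (s + 1)) / M ^ 2 := by
      field_simp; ring
    rw [this]; positivity

theorem abs_sub_div_sq_le_of_recurrence {m : ℝ} (hm : 0 < m) {ρ σ : ℕ → ℝ} (h0 : σ 0 = 1)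
    (hρ : ∀ s : ℕ, |ρ s - m / (m + 2 * s)| ≤ 2 * s / m ^ 2)
    (hrec : ∀ s : ℕ, (m + 1 + s + 1) * σ (s + 1) = (m + 1) * ρ (s + 1) - (s + 1) * σ s) (s : ℕ) :
    |σ s - ((m + 1) / (m + 1 + 2 * s)) ^ 2| ≤ 8 * s / m ^ 2 := by
  induction s with
  | zero => simp [h0, (show m + 1 ≠ 0 by positivity)]
  | succ s ih =>
    have hs : (0 : ℝ) ≤ s := s.cast_nonneg
    have hρ' := hρ (s + 1)
    push_cast at hρ' ⊢
    set r : ℝ := m / (m + 2 * (s + 1)) with hr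
    set g : ℝ := (m + 1) / (m + 1 + 2 * s) with hg
    set g' : ℝ := (m + 1) / (m + 1 + 2 * (s + 1)) with hg'
    have hrg : |r - g'| ≤ 2 * (s + 1) / m ^ 2 := by
      rw [abs_sub_comm, hr, hg', div_sub_div _ _ (by positivity) (by positivity), abs_of_nonneg
        (div_nonneg (by nlinarith) (by positivity)),
        div_le_div_iff₀ (by positivity) (by positivity)]
      have : (m + 1) * (m + 2 * (s + 1)) - (m + 1 + 2 * (s + 1)) * m = 2 * ((s : ℝ) + 1) := by ring
      rw [this]
      gcongr
      nlinarith
    have hgg0 : 0 ≤ g - g' := by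
      rw [hg, hg', div_sub_div _ _ (by positivity) (by positivity)]
      exact div_nonneg (by nlinarith) (by positivity)
    have hgg1 : g - g' ≤ 2 / (m + 1) := by
      rw [hg, hg', div_sub_div _ _ (by positivity) (by positivity),
        div_le_div_iff₀ (by positivity) (by positivity)]
      nlinarith [mul_nonneg hm.le hs, mul_nonneg hs hs]
    have hg1 : g ≤ 1 := by rw [hg, div_le_one (by positivity)]; linarith
    have hg'0 : 0 ≤ g' := by positivity
    have hsq : |g ^ 2 - g' ^ 2| ≤ 4 * (m + 1) / m ^ 2 := by
      have h4 : g ^ 2 - g' ^ 2 ≤ 4 / (m + 1) := by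
        have e : (4 : ℝ) / (m + 1) = 2 * (2 / (m + 1)) := by ring
        rw [e]
        nlinarith
      rw [abs_of_nonneg (by nlinarith)]
      refine h4.trans ?_
      rw [div_le_div_iff₀ (by positivity) (by positivity)]
      nlinarith
    have key : (m + 1 + s + 1) * (σ (s + 1) - g' ^ 2) =
        (m + 1) * ((ρ (s + 1) - r) + (r - g')) - (s + 1) * ((σ s - g ^ 2) + (g ^ 2 - g' ^ 2)) := by
      have : (m + 1 + s + 1) * g' ^ 2 = (m + 1) * g' - (s + 1) * g' ^ 2 := by
        rw [hg']; field_simp; ring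
      linear_combination hrec s - this
    have h2 : (m + 1 + s + 1) * |σ (s + 1) - g' ^ 2| ≤
        (m + 1) * (2 * (s + 1) / m ^ 2 + 2 * (s + 1) / m ^ 2) +
          (s + 1) * (8 * s / m ^ 2 + 4 * (m + 1) / m ^ 2) := by
      rw [← abs_of_pos (show 0 < m + 1 + s + 1 by positivity), ← abs_mul, key]
      refine (abs_sub _ _).trans ?_
      rw [abs_mul, abs_mul, abs_of_pos (show 0 < m + 1 by positivity),
        abs_of_pos (show (0 : ℝ) < s + 1 by positivity)]
      gcongr
      · exact (abs_add_le _ _).trans (add_le_add hρ' hrg)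
      · exact (abs_add_le _ _).trans (add_le_add ih hsq)
    refine le_of_mul_le_mul_left (h2.trans ?_) (show 0 < m + 1 + s + 1 by positivity)
    rw [← sub_nonneg]
    have : (m + 1 + s + 1) * (8 * (s + 1) / m ^ 2) -
        ((m + 1) * (2 * (s + 1) / m ^ 2 + 2 * (s + 1) / m ^ 2) +
          (s + 1) * (8 * s / m ^ 2 + 4 * (m + 1) / m ^ 2)) = 8 * (s + 1) / m ^ 2 := by
      field_simp; ring
    rw [this]; positivity

theorem abs_signedCount_one_sub_le (m t : ℕ) (hm : 0 < m) :
    |signedCount m 1 t / signedCount (m + 1) 0 t - m / (m + 2 * t)| ≤ 2 * t / (m : ℝ) ^ 2 := by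
  refine abs_sub_div_le_of_recurrence (M := m)
    (ρ := fun t => signedCount m 1 t / signedCount (m + 1) 0 t) (by exact_mod_cast hm)
    (by simp [signedCount_zero]) (fun s => ?_) t
  have h0 := signedCount_pos m s
  have h1 := signedCount_pos m (s + 1)
  have e1 := succ_mul_signedCount_succ m s
  have e2 := add_mul_signedCount m s
  have e3 := signedCount_succ_right m 0 s
  simp only [zero_add] at e3
  field_simp
  linear_combination (m + s + 1 : ℝ) * signedCount (m + 1) 0 s * e3 +
    signedCount (m + 1) 0 s * e2 + signedCount m 1 s * e1

theorem abs_signedCount_two_sub_le (m t : ℕ) (hm : 0 < m) :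
    |signedCount m 2 t / signedCount (m + 2) 0 t - ((m + 1) / (m + 1 + 2 * t)) ^ 2| ≤
      8 * t / (m : ℝ) ^ 2 := by
  refine abs_sub_div_sq_le_of_recurrence (m := m)
    (σ := fun t => signedCount m 2 t / signedCount (m + 2) 0 t) (by exact_mod_cast hm)
    (by simp [signedCount_zero]) (fun s => abs_signedCount_one_sub_le m s hm) (fun s => ?_) t
  have h0 := signedCount_pos (m + 1) s
  have h1 := signedCount_pos (m + 1) (s + 1)
  have h2 := signedCount_pos m (s + 1)
  have e1 := succ_mul_signedCount_succ (m + 1) s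
  have e2 := add_mul_signedCount (m + 1) s
  have e3 := signedCount_succ_right m 1 s
  simp only [Nat.add_assoc, Nat.reduceAdd] at e1 e2 e3 h0 h1
  push_cast at e1 e2
  field_simp
  linear_combination (m + 1 + s + 1 : ℝ) * signedCount (m + 2) 0 s * signedCount (m + 1) 0 (s + 1) *
    e3 + signedCount (m + 2) 0 s * signedCount m 1 (s + 1) * e2 +
    signedCount m 2 s * signedCount (m + 1) 0 (s + 1) * e1

theorem sum_piAntidiag_sum_neg_one_pow (m t : ℕ) :
    ∑ C ∈ piAntidiag (univ : Finset (Fin (m + 1))) t, ∑ i, (-1 : ℝ) ^ C i =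
      (m + 1) * signedCount m 1 t := by
  rw [sum_comm, sum_congr rfl fun i _ => by
    simpa using sum_piAntidiag_prod_neg_one_pow ({i} : Finset (Fin (m + 1))) t]
  simp

theorem sum_piAntidiag_sum_neg_one_pow_sq (m t : ℕ) :
    ∑ C ∈ piAntidiag (univ : Finset (Fin (m + 2))) t, (∑ i, (-1 : ℝ) ^ C i) ^ 2 =
      (m + 2) * signedCount (m + 2) 0 t + (m + 2) * (m + 1) * signedCount m 2 t := by
  have h : ∀ i j : Fin (m + 2), ∑ C ∈ piAntidiag (univ : Finset (Fin (m + 2))) t,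
      (-1 : ℝ) ^ C i * (-1 : ℝ) ^ C j =
        if i = j then signedCount (m + 2) 0 t else signedCount m 2 t := by
    intro i j
    split_ifs with hij
    · subst hij
      simpa [← mul_pow] using sum_piAntidiag_prod_neg_one_pow (∅ : Finset (Fin (m + 2))) t
    · simpa [prod_pair hij, card_pair hij] using
        sum_piAntidiag_prod_neg_one_pow ({i, j} : Finset (Fin (m + 2))) t
  simp_rw [sq, sum_mul_sum]
  rw [sum_comm, sum_congr rfl fun i _ => by
    rw [sum_comm, sum_congr rfl fun j _ => h i j, ← add_sum_erase _ _ (mem_univ i), if_pos rfl,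
      sum_congr rfl fun j hj => if_neg (ne_of_mem_erase hj).symm]]
  simp
  ring

theorem card_piAntidiag_univ_fin (m t : ℕ) :
    (#(piAntidiag (univ : Finset (Fin (m + 1))) t) : ℝ) = signedCount (m + 1) 0 t := by
  simpa using sum_piAntidiag_prod_neg_one_pow (∅ : Finset (Fin (m + 1))) t

/-- Second moment of the difference between the numbers of even and odd piles. -/
theorem sum_piAntidiag_sub_sq_le {m t : ℕ} (hm : 2 ≤ m) (ht : t ≤ 2 * (m + 2)) :
    ∑ C ∈ piAntidiag (univ : Finset (Fin (m + 2))) t,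
      (∑ i, (-1 : ℝ) ^ C i - (m + 2) * ((m + 1) / (m + 1 + 2 * t))) ^ 2 ≤
      97 * (m + 2) * signedCount (m + 2) 0 t := by
  have hN : 0 < signedCount (m + 2) 0 t := signedCount_pos (m + 1) t
  have hm' : (2 : ℝ) ≤ m := by exact_mod_cast hm
  have ht' : (t : ℝ) ≤ 2 * (m + 2) := by exact_mod_cast ht
  have ht0 : (0 : ℝ) ≤ t := t.cast_nonneg
  have h1 := abs_signedCount_one_sub_le (m + 1) t (by omega)
  have h2 := abs_signedCount_two_sub_le m t (by omega)
  push_cast at h1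
  set g : ℝ := (m + 1) / (m + 1 + 2 * t) with hg
  have hg0 : 0 ≤ g := by positivity
  have hg1 : g ≤ 1 := by rw [hg, div_le_one (by positivity)]; linarith
  set ρ := signedCount (m + 1) 1 t / signedCount (m + 2) 0 t with hρ
  set σ := signedCount m 2 t / signedCount (m + 2) 0 t with hσ
  have e1 : signedCount (m + 1) 1 t = ρ * signedCount (m + 2) 0 t := by rw [hρ]; field_simp
  have e2 : signedCount m 2 t = σ * signedCount (m + 2) 0 t := by rw [hσ]; field_simp
  have hsum1 : ∑ C ∈ piAntidiag (univ : Finset (Fin (m + 2))) t, ∑ i, (-1 : ℝ) ^ C i =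
      ((m + 1 : ℕ) + 1) * signedCount (m + 1) 1 t := sum_piAntidiag_sum_neg_one_pow (m + 1) t
  simp_rw [sub_sq]
  rw [sum_add_distrib, sum_sub_distrib, sum_piAntidiag_sum_neg_one_pow_sq, ← sum_mul, ← mul_sum,
    hsum1, sum_const, nsmul_eq_mul, card_piAntidiag_univ_fin (m + 1), e1, e2]
  push_cast
  set q : ℝ := 8 * t / (m : ℝ) ^ 2 with hq
  have h1' : g - q / 4 ≤ ρ := by
    have : 2 * t / ((m : ℝ) + 1) ^ 2 ≤ q / 4 := by
      rw [hq, show 8 * (t : ℝ) / (m : ℝ) ^ 2 / 4 = 2 * t / (m : ℝ) ^ 2 by ring]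
      gcongr; linarith
    linarith [(abs_le.1 h1).1]
  have h2' : σ ≤ g ^ 2 + q := by linarith [(abs_le.1 h2).2]
  have hq0 : 0 ≤ q := by positivity
  have hqm : (m + 2) * q ≤ 64 := by
    rw [hq, mul_div_assoc', div_le_iff₀ (by positivity)]
    nlinarith [mul_le_mul_of_nonneg_left ht' (show (0:ℝ) ≤ m + 2 by positivity)]
  have hA : (m + 2) * (m + 1) * σ ≤ (m + 2) ^ 2 * (g ^ 2 + q) := by
    calc (m + 2) * (m + 1) * σ ≤ (m + 2) * (m + 1) * (g ^ 2 + q) := by gcongr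
      _ ≤ (m + 2) ^ 2 * (g ^ 2 + q) := by
        gcongr
        nlinarith
  have hB : (m + 2) ^ 2 * (g * (g - q / 4)) ≤ (m + 2) ^ 2 * (g * ρ) := by gcongr
  have hC : (m + 2) ^ 2 * (g * q) ≤ (m + 2) ^ 2 * q := by
    gcongr
    nlinarith
  have hD := mul_le_mul_of_nonneg_left hqm (show (0:ℝ) ≤ m + 2 by positivity)
  have hfin : (m + 2) + (m + 2) * (m + 1) * σ - 2 * (m + 2) ^ 2 * (g * ρ) + (m + 2) ^ 2 * g ^ 2 ≤
      97 * (m + 2 : ℝ) := by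
    nlinarith
  calc _ = ((m + 2) + (m + 2) * (m + 1) * σ - 2 * (m + 2) ^ 2 * (g * ρ) + (m + 2) ^ 2 * g ^ 2) *
        signedCount (m + 2) 0 t := by ring
    _ ≤ _ := by gcongr

theorem sum_neg_one_pow_eq {n : ℕ} (C : Fin n → ℕ) :
    ∑ i, (-1 : ℝ) ^ C i = 2 * #{i | Even (C i)} - n := by
  have h : ∀ i, (-1 : ℝ) ^ C i = 2 * (if Even (C i) then 1 else 0) - 1 := by
    intro i
    split_ifs with hi
    · rw [hi.neg_one_pow]; norm_num
    · rw [(Nat.not_even_iff_odd.1 hi).neg_one_pow]; norm_num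
  simp_rw [h]
  rw [sum_sub_distrib, ← mul_sum, sum_boole]
  simp

open Classical in
theorem beCoverProb_eq (m t : ℕ) :
    beCoverProb (m + 1) t =
      #{C ∈ piAntidiag (univ : Finset (Fin (m + 1))) t | CoverSolvable ⊤ C} /
        (#(piAntidiag (univ : Finset (Fin (m + 1))) t) : ℝ) := by
  rw [beCoverProb, card_piAntidiag_univ_fin, signedCount_eq_choose]
  congr 2
  · rw [← Nat.card_eq_finsetCard]
    exact Nat.card_congr (Equiv.subtypeEquivRight fun C => by simp)
  · congr 1
    omega

theorem beCoverProb_le_one (m t : ℕ) : beCoverProb (m + 1) t ≤ 1 := by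
  classical
  rw [beCoverProb_eq]
  exact div_le_one_of_le₀ (by exact_mod_cast card_filter_le _ _) (Nat.cast_nonneg _)

/-- Chebyshev's inequality for the number of even piles. -/
theorem one_sub_le_beCoverProb {m t : ℕ} (hm : 2 ≤ m) {δ : ℝ} (hδ : 0 < δ)
    (hgap : δ ≤ 2 * t - 3 * (m + 2) - (m + 2) * ((m + 1) / (m + 1 + 2 * t))) :
    1 - 97 * (m + 2) / δ ^ 2 ≤ beCoverProb (m + 2) t := by
  classical
  set T := piAntidiag (univ : Finset (Fin (m + 2))) t with hT
  have hTpos : (0 : ℝ) < #T := by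
    rw [hT, card_piAntidiag_univ_fin (m + 1)]; exact signedCount_pos (m + 1) t
  have hbad : (#{C ∈ T | ¬ CoverSolvable ⊤ C} : ℝ) * δ ^ 2 ≤ 97 * (m + 2) * #T := by
    by_cases ht : t ≤ 2 * (m + 2)
    · set F : (Fin (m + 2) → ℕ) → ℝ := fun C =>
        (∑ i, (-1 : ℝ) ^ C i - (m + 2) * ((m + 1) / (m + 1 + 2 * t))) ^ 2 with hF
      have hle : ∀ C ∈ T.filter fun C => ¬ CoverSolvable ⊤ C, δ ^ 2 ≤ F C := by
        intro C hC
        obtain ⟨hCT, hCs⟩ := mem_filter.1 hC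
        have hsum : ∑ i, C i = t := (mem_piAntidiag.1 hCT).1
        have hlt : t < #{i | Even (C i)} + (m + 2) := by
          by_contra! hle
          exact hCs (coverSolvable_top_of_card_even_add_card_le C (by simpa [hsum] using hle))
        have hlt' : (t : ℝ) < #{i | Even (C i)} + (m + 2) := by exact_mod_cast hlt
        refine pow_le_pow_left₀ hδ.le (hgap.trans ?_) 2
        rw [sum_neg_one_pow_eq]
        push_cast
        linarith
      calc (#{C ∈ T | ¬ CoverSolvable ⊤ C} : ℝ) * δ ^ 2
          ≤ ∑ C ∈ T with ¬ CoverSolvable ⊤ C, F C := by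
            rw [← nsmul_eq_mul]
            exact card_nsmul_le_sum _ _ _ hle
        _ ≤ ∑ C ∈ T, F C :=
            sum_le_sum_of_subset_of_nonneg (filter_subset _ _) fun _ _ _ => sq_nonneg _
        _ ≤ 97 * (m + 2) * signedCount (m + 2) 0 t := sum_piAntidiag_sub_sq_le hm ht
        _ = 97 * (m + 2) * #T := by rw [hT, card_piAntidiag_univ_fin (m + 1)]
    · rw [filter_false_of_mem fun C hC => ?_]
      · simp only [card_empty, Nat.cast_zero, zero_mul]; positivity
      · rw [not_not]
        have hsum : ∑ i, C i = t := (mem_piAntidiag.1 hC).1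
        refine coverSolvable_top_of_card_even_add_card_le C ?_
        have := card_filter_le (univ : Finset (Fin (m + 2))) fun i => Even (C i)
        simp only [card_univ, Fintype.card_fin] at this ⊢
        omega
  have hsplit : (#{C ∈ T | CoverSolvable ⊤ C} : ℝ) + #{C ∈ T | ¬ CoverSolvable ⊤ C} = #T := by
    exact_mod_cast card_filter_add_card_filter_not (s := T) _
  rw [beCoverProb_eq (m + 1), le_div_iff₀ hTpos]
  have : (#{C ∈ T | ¬ CoverSolvable ⊤ C} : ℝ) ≤ 97 * (m + 2) / δ ^ 2 * #T := by
    rw [div_mul_eq_mul_div, le_div_iff₀ (by positivity)]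
    exact hbad
  linarith

theorem two_mul_sub_le_gap {n t : ℝ} (hn : 1 ≤ n) (ht : (1 + √5) / 2 * n ≤ t) :
    2 * (t - (1 + √5) / 2 * n) ≤ 2 * t - 3 * n - n * ((n - 1) / (n - 1 + 2 * t)) := by
  have h5 : √5 ^ 2 = 5 := Real.sq_sqrt (by norm_num)
  have h2 : 2 ≤ √5 := Real.le_sqrt_of_sq_le (by norm_num)
  have ht0 : n ≤ t := le_trans (by nlinarith) ht
  have hfrac : (n - 1) / (n - 1 + 2 * t) ≤ n / (n + 2 * t) := by
    rw [div_le_div_iff₀ (by linarith) (by linarith)]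
    nlinarith
  have hmul := mul_le_mul_of_nonneg_left hfrac (show 0 ≤ n by linarith)
  have key : 2 * (t - (1 + √5) / 2 * n) ≤ 2 * t - 3 * n - n * (n / (n + 2 * t)) := by
    have hpos : 0 < n + 2 * t := by linarith
    rw [← sub_nonneg]
    have : 2 * t - 3 * n - n * (n / (n + 2 * t)) - 2 * (t - (1 + √5) / 2 * n) =
        2 * (t - (1 + √5) / 2 * n) * ((√5 - 2) * n) / (n + 2 * t) := by
      field_simp
      linear_combination n ^ 2 * h5
    rw [this]
    refine div_nonneg (mul_nonneg (by linarith) (mul_nonneg (by linarith) (by linarith))) hpos.le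
  linarith

/-- Let `γ = (1+√5)/2` be the golden ratio and `φ(n) → ∞`.  If
`t(n) = γ·n + φ(n)·√n` (up to rounding), then the probability that a uniformly
random Bose Einstein configuration of `t(n)` pebbles on `K_n` is cover solvable
tends to `1`. -/
theorem be_cover_threshold_upper (φ : ℕ → ℝ)
    (hφ : Filter.Tendsto φ Filter.atTop Filter.atTop) (t : ℕ → ℕ)
    (ht : ∀ n, |(t n : ℝ) - ((1 + Real.sqrt 5) / 2 * n + φ n * Real.sqrt n)| ≤ 1) :
    Filter.Tendsto (fun n => beCoverProb n (t n)) Filter.atTop (nhds 1) := by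
  have hlim : Filter.Tendsto (fun n => 1 - 97 / φ n ^ 2) Filter.atTop (nhds 1) := by
    have := (((Filter.tendsto_pow_atTop two_ne_zero).comp hφ).const_div_atTop (97 : ℝ)).const_sub 1
    simpa using this
  refine tendsto_of_tendsto_of_tendsto_of_le_of_le' hlim tendsto_const_nhds ?_ ?_
  · filter_upwards [hφ.eventually_ge_atTop 2, Filter.eventually_ge_atTop 4] with n hn2 hn4
    obtain ⟨m, rfl⟩ : ∃ m, n = m + 2 := ⟨n - 2, by omega⟩
    have ht' := (abs_le.1 (ht (m + 2))).1
    push_cast at ht'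
    have hm : (2 : ℝ) ≤ m := by exact_mod_cast (show 2 ≤ m by omega)
    have hs : 2 ≤ √((m : ℝ) + 2) := Real.le_sqrt_of_sq_le (by linarith)
    have hprod : 4 ≤ φ (m + 2) * √((m : ℝ) + 2) := by nlinarith
    have hgap := two_mul_sub_le_gap (n := (m : ℝ) + 2) (t := t (m + 2)) (by linarith)
      (by linarith)
    rw [show (m : ℝ) + 2 - 1 = m + 1 by ring] at hgap
    have := one_sub_le_beCoverProb (m := m) (t := t (m + 2)) (by omega)
      (δ := φ (m + 2) * √((m : ℝ) + 2)) (by linarith) (by linarith)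
    rwa [mul_pow, Real.sq_sqrt (by linarith), mul_div_mul_right _ _ (by linarith)] at this
  · filter_upwards [Filter.eventually_ge_atTop 1] with n hn
    obtain ⟨m, rfl⟩ : ∃ m, n = m + 1 := ⟨n - 1, by omega⟩
    exact beCoverProb_le_one m _
end

section
/- Let γ = (1+√5)/2 be the golden ratio, and let φ : ℕ → ℝ be any function with φ(n) → ∞ as n → ∞. If t = t(n) is a sequence of integers with t(n) = γ·n − φ(n)·√n (up to rounding), and a configuration of t(n) pebbles on the vertices of the complete graph K_n is chosen uniformly at random from all C(n+t−1, n−1) configurations of weight t(n) (Bose Einstein scheme), then the probability that the configuration is cover solvable tends to 0 as n → ∞. -/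
open Finset in
/-- The number of vertices carrying an even number of pebbles. -/
def evenCount {V : Type*} [Fintype V] (C : V → ℕ) : ℕ := #{v | Even (C v)}

/-- The contribution of a vertex with `c` pebbles to the monovariant given by the weight minus the
number of even vertices. -/
def evenDefect (c : ℕ) : ℤ := c - if Even c then 1 else 0

lemma evenDefect_add_one_le (c : ℕ) : evenDefect (c + 1) ≤ evenDefect c + 2 := by
  unfold evenDefect
  push_cast
  split_ifs <;> omega

lemma evenDefect_add_two (c : ℕ) : evenDefect (c + 2) = evenDefect c + 2 := by
  unfold evenDefect
  simp only [Nat.even_add, even_two, iff_true]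
  push_cast
  ring

lemma one_le_evenDefect {c : ℕ} (hc : 1 ≤ c) : 1 ≤ evenDefect c := by
  unfold evenDefect
  split_ifs with h
  · obtain ⟨k, rfl⟩ := h
    push_cast
    omega
  · omega

lemma sum_evenDefect {V : Type*} [Fintype V] (C : V → ℕ) :
    ∑ v, evenDefect (C v) = (∑ v, C v : ℕ) - (evenCount C : ℤ) := by
  simp [evenDefect, evenCount, Finset.sum_sub_distrib]

lemma PebblingMove.sum_evenDefect_le {V : Type*} [Fintype V] [DecidableEq V] {G : SimpleGraph V}
    {C C' : V → ℕ} (h : PebblingMove G C C') :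
    ∑ v, evenDefect (C' v) ≤ ∑ v, evenDefect (C v) := by
  obtain ⟨u, v, hadj, h2, rfl⟩ := h
  have huv : u ≠ v := hadj.ne
  rw [← sub_nonpos, ← Finset.sum_sub_distrib, Fintype.sum_eq_add u v huv]
  · obtain ⟨c, hc⟩ := Nat.exists_eq_add_of_le' h2
    have h₁ := evenDefect_add_two c
    have h₂ := evenDefect_add_one_le (C v)
    simp only [Function.update_self, Function.update_of_ne huv, hc, Nat.add_sub_cancel]
    omega
  · rintro w ⟨hu, hv⟩
    simp [Function.update_of_ne hu, Function.update_of_ne hv]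

/-- A cover solvable configuration has weight at least the number of vertices plus the number of
even vertices. -/
lemma CoverSolvable.card_add_evenCount_le {V : Type*} [Fintype V] [DecidableEq V]
    {G : SimpleGraph V} {C : V → ℕ} (h : CoverSolvable G C) :
    Fintype.card V + evenCount C ≤ ∑ v, C v := by
  obtain ⟨C', hC, h1⟩ := h
  have hmono : ∑ v, evenDefect (C' v) ≤ ∑ v, evenDefect (C v) := by
    clear h1
    induction hC with
    | refl => exact le_rfl
    | tail _ hmove ih => exact hmove.sum_evenDefect_le.trans ih
  have hlow : (Fintype.card V : ℤ) ≤ ∑ v, evenDefect (C' v) := by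
    simpa using Finset.sum_le_sum fun v (_ : v ∈ Finset.univ) => one_le_evenDefect (h1 v)
  rw [sum_evenDefect C] at hmono
  omega

open Finset in
lemma card_piAntidiag_nat_eq_choose {ι : Type*} [DecidableEq ι] (s : Finset ι) (m : ℕ) :
    #(piAntidiag s m) = (#s + m - 1).choose m := by
  simp [← card_finsuppAntidiag_nat_eq_choose, finsuppAntidiag]

open Finset in
/-- A configuration with exactly `k` even vertices is determined by the set of those vertices
together with the halves of its values. -/
lemma card_evenCount_eq {n t k m : ℕ} (h : n + 2 * m = t + k) :
    #{C ∈ piAntidiag (univ : Finset (Fin n)) t | evenCount C = k} =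
      n.choose k * (n + m - 1).choose m := by
  have hodd (S : Finset (Fin n)) : (∑ v, if v ∈ S then 0 else 1) + #S = n := by
    have := card_compl_add_card S
    rw [Fintype.card_fin] at this
    have hcompl : (∑ v, if v ∈ S then 0 else 1) = #Sᶜ := by
      rw [card_eq_sum_ones, ← sum_subset (subset_univ Sᶜ)]
      · exact sum_congr rfl fun v hv => if_neg (mem_compl.1 hv)
      · intro v _ hv
        simpa using hv
    omega
  have hcard : #(powersetCard k (univ : Finset (Fin n)) ×ˢ piAntidiag (univ : Finset (Fin n)) m) =
      n.choose k * (n + m - 1).choose m := by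
    simp [card_piAntidiag_nat_eq_choose]
  rw [← hcard]
  refine card_nbij' (fun C => (univ.filter fun v => Even (C v), fun v => C v / 2))
    (fun p v => 2 * p.2 v + if v ∈ p.1 then 0 else 1) ?_ ?_ ?_ ?_
  · intro C hC
    simp only [mem_coe, mem_filter, mem_piAntidiag] at hC
    obtain ⟨⟨hsum, -⟩, hk⟩ := hC
    have hdecomp : ∑ v, C v =
        2 * ∑ v, C v / 2 + ∑ v, if v ∈ univ.filter (fun v => Even (C v)) then 0 else 1 := by
      rw [mul_sum, ← sum_add_distrib]
      refine sum_congr rfl fun v _ => ?_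
      simp only [mem_filter, mem_univ, true_and, Nat.even_iff]
      split_ifs <;> omega
    have := hodd (univ.filter fun v => Even (C v))
    rw [evenCount] at hk
    change ∑ v, C v = t at hsum
    simp only [mem_coe, mem_product, mem_powersetCard_univ, mem_piAntidiag]
    refine ⟨hk, ?_, by simp⟩
    omega
  · rintro ⟨S, D⟩ hp
    simp only [mem_coe, mem_product, mem_powersetCard_univ, mem_piAntidiag] at hp
    obtain ⟨hS, hD, -⟩ := hp
    have := hodd S
    change ∑ v, D v = m at hD
    simp only [mem_coe, mem_filter, mem_piAntidiag]
    refine ⟨⟨?_, by simp⟩, ?_⟩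
    · rw [sum_add_distrib, ← mul_sum]
      omega
    · rw [← hS, evenCount]
      congr 1
      ext v
      by_cases hv : v ∈ S <;> simp [hv, Nat.even_add]
  · intro C _
    funext v
    simp only [mem_filter, mem_univ, true_and, Nat.even_iff]
    split_ifs <;> omega
  · rintro ⟨S, D⟩ _
    ext v
    · by_cases hv : v ∈ S <;> simp [hv, Nat.even_add]
    · simp only
      split_ifs <;> omega

open Finset in
lemma card_evenCount_eq_zero {n t k : ℕ} (h : Odd (n + t + k)) :
    #{C ∈ piAntidiag (univ : Finset (Fin n)) t | evenCount C = k} = 0 := by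
  refine card_eq_zero.2 (filter_eq_empty_iff.2 fun C hC hk => ?_)
  rw [mem_piAntidiag] at hC
  have hparity : Even (∑ v, (C v + 1 + if Even (C v) then 1 else 0)) := by
    refine even_sum _ fun v _ => ?_
    split_ifs with hv <;> simp [Nat.even_add_one, hv]
  have hsum : ∑ v, (C v + 1 + if Even (C v) then 1 else 0) = n + t + k := by
    rw [← hC.1, ← hk]
    simp [sum_add_distrib, evenCount]
    ring
  rw [hsum] at hparity
  exact Nat.not_even_iff_odd.2 h hparity

lemma choose_mul_choose_step {n k m : ℕ} (hn : 1 ≤ n) :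
    n.choose (k + 2) * (n + m).choose (m + 1) * ((k + 1) * (k + 2) * (m + 1)) =
      n.choose k * (n + m - 1).choose m * ((n - k) * (n - (k + 1)) * (n + m)) := by
  have h₁ := Nat.choose_succ_right_eq n k
  have h₂ := Nat.choose_succ_right_eq n (k + 1)
  have h₃ := Nat.add_one_mul_choose_eq (n + m - 1) m
  rw [Nat.sub_add_cancel (by omega)] at h₃
  calc _ = (n.choose (k + 1 + 1) * (k + 1 + 1)) * (k + 1) *
        ((n + m).choose (m + 1) * (m + 1)) := by ring
    _ = (n.choose (k + 1) * (k + 1)) * (n - (k + 1)) * ((n + m).choose (m + 1) * (m + 1)) := by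
        rw [h₂]; ring
    _ = _ := by rw [h₁, ← h₃]; ring

/-- The polynomial inequality behind the growth of the number of configurations with `k` even
vertices; `g = (√5 - 1) / 2` is the inverse of the golden ratio. -/
lemma cube_mul_le_of_add_le {g n u w : ℝ} (hg : g ^ 2 + g = 1) (hn : 0 < n)
    (hu : 0 ≤ u) (hw : 0 ≤ w) (h : u + w ≤ g * n) :
    (n + w) * u ^ 3 ≤ n * ((n - u) ^ 2 * (n + u)) := by
  have hun : u ≤ n := by nlinarith
  have hkey : w * n ≤ n ^ 2 - n * u - u ^ 2 := by
    have hfac : n ^ 2 - n * u - u ^ 2 = (g * n - u) * ((1 + g) * n + u) := by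
      linear_combination (-n ^ 2) * hg
    rw [hfac]
    apply mul_le_mul <;> nlinarith
  have hu3 : u ^ 3 ≤ n ^ 3 := pow_le_pow_left₀ hu hun 3
  have hn2 : 0 < n ^ 2 := by positivity
  nlinarith [mul_le_mul_of_nonneg_left hu3 hw, mul_le_mul_of_nonneg_left hkey hn2.le]

/-- Below the typical number of even vertices, the number of configurations with `k` even vertices
grows by a factor of at least `1 + w / n` when `k` increases by two. -/
lemma card_evenCount_growth {g w : ℝ} {n s k J : ℕ} (hg : g ^ 2 + g = 1) (hg0 : 0 < g)
    (hn : 1 ≤ n) (hw : 0 ≤ w) (hk : k + 2 ≤ s + 2 * J) (h : s + 2 * J + 1 + w ≤ g * n) :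
    (1 + w / n) *
      ((Finset.piAntidiag (Finset.univ : Finset (Fin n)) (n + s)).filter
        fun C => evenCount C = k).card ≤
      ((Finset.piAntidiag (Finset.univ : Finset (Fin n)) (n + s)).filter
        fun C => evenCount C = k + 2).card := by
  rcases Nat.even_or_odd (s + k) with hpar | hpar
  · obtain ⟨m, hm⟩ := hpar
    rw [card_evenCount_eq (m := m) (by omega), card_evenCount_eq (m := m + 1) (by omega)]
    have hn0 : (0 : ℝ) < n := by exact_mod_cast hn
    have hstep := choose_mul_choose_step (k := k) (m := m) hn
    rw [show n + (m + 1) - 1 = n + m by omega]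
    set u : ℝ := s + 2 * J + 1 with hu
    have hun : u ≤ n := by nlinarith
    have hkJ : (k : ℝ) + 2 ≤ u - 1 := by
      have : ((k + 2 : ℕ) : ℝ) ≤ (s + 2 * J : ℕ) := by exact_mod_cast hk
      push_cast at this
      linarith
    have hmJ : (m : ℝ) + 2 ≤ u := by
      have : ((m + 2 : ℕ) : ℝ) ≤ (s + 2 * J + 1 : ℕ) := by exact_mod_cast (by omega)
      push_cast at this
      linarith
    have hcast : ((n.choose (k + 2) * (n + m).choose (m + 1) : ℕ) : ℝ) *
        ((k + 1) * (k + 2) * (m + 1)) =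
        ((n.choose k * (n + m - 1).choose m : ℕ) : ℝ) * ((n - k) * (n - (k + 1)) * (n + m)) := by
      have hkn : k + 1 ≤ n := by
        have : (k : ℝ) + 1 ≤ n := by linarith
        exact_mod_cast this
      have := congrArg (Nat.cast : ℕ → ℝ) hstep
      push_cast [Nat.cast_sub hkn, Nat.cast_sub (show k ≤ n by omega)] at this
      push_cast
      exact this
    set a : ℝ := ((n.choose k * (n + m - 1).choose m : ℕ) : ℝ)
    set b : ℝ := ((n.choose (k + 2) * (n + m).choose (m + 1) : ℕ) : ℝ)
    have ha : 0 ≤ a := Nat.cast_nonneg _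
    have hk0 : (0 : ℝ) ≤ k := Nat.cast_nonneg _
    have hm0 : (0 : ℝ) ≤ m := Nat.cast_nonneg _
    have hcube := cube_mul_le_of_add_le hg hn0 (by linarith : 0 ≤ u) hw h
    have hu0 : 0 < u := by linarith
    have hratio : (1 + w / n) * ((k + 1) * (k + 2) * (m + 1)) ≤
        (n - k) * (n - (k + 1)) * (n + m) := by
      have h₁ : (1 + w / n) * u ^ 3 ≤ (n - u) ^ 2 * (n + u) := by
        rw [show (1 + w / n) = (n + w) / n by field_simp, div_mul_eq_mul_div, div_le_iff₀ hn0]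
        linarith
      have h₂ : (n + u) * (m + 1) ≤ u * (n + m) := by nlinarith
      have h₃ : ((k : ℝ) + 1) * (k + 2) ≤ u ^ 2 := by nlinarith
      have h₄ : (n - u) ^ 2 ≤ (n - k) * (n - (k + 1)) := by nlinarith
      have hr : 0 ≤ 1 + w / n := by positivity
      refine le_of_mul_le_mul_right ?_ hu0
      calc (1 + w / n) * ((k + 1) * (k + 2) * (m + 1)) * u
          ≤ (1 + w / n) * (u ^ 2 * (m + 1)) * u := by gcongr
        _ = (1 + w / n) * u ^ 3 * (m + 1) := by ring
        _ ≤ (n - u) ^ 2 * (n + u) * (m + 1) := by gcongr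
        _ = (n - u) ^ 2 * ((n + u) * (m + 1)) := by ring
        _ ≤ (n - u) ^ 2 * (u * (n + m)) := by gcongr
        _ ≤ (n - k) * (n - (k + 1)) * (u * (n + m)) := by gcongr
        _ = _ := by ring
    have hpos : (0 : ℝ) < (k + 1) * (k + 2) * (m + 1) := by positivity
    refine le_of_mul_le_mul_right ?_ hpos
    calc _ = a * ((1 + w / n) * ((k + 1) * (k + 2) * (m + 1))) := by ring
      _ ≤ a * ((n - k) * (n - (k + 1)) * (n + m)) := by gcongr
      _ = _ := hcast.symm
  · rw [card_evenCount_eq_zero]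
    · simp
    · rw [show n + (n + s) + k = 2 * n + (s + k) by ring]
      exact (even_two_mul n).add_odd hpar

/-- If every term among the first `N + 2 * J` gains a factor `r` under a shift by two, then partial
sums grow geometrically. -/
lemma pow_mul_sum_range_le {f : ℕ → ℝ} {r : ℝ} {N J : ℕ} (hf : ∀ k, 0 ≤ f k) (hr : 0 ≤ r)
    (h : ∀ k, k + 2 < N + 2 * J → r * f k ≤ f (k + 2)) :
    r ^ J * ∑ k ∈ Finset.range N, f k ≤ ∑ k ∈ Finset.range (N + 2 * J), f k := by
  induction J with
  | zero => simp
  | succ J ih =>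
    calc r ^ (J + 1) * ∑ k ∈ Finset.range N, f k
        = r * (r ^ J * ∑ k ∈ Finset.range N, f k) := by ring
      _ ≤ r * ∑ k ∈ Finset.range (N + 2 * J), f k := by
          gcongr
          exact ih fun k hk => h k (by omega)
      _ ≤ ∑ k ∈ Finset.range (N + 2 * J), f (k + 2) := by
          rw [Finset.mul_sum]
          refine Finset.sum_le_sum fun k hk => h k ?_
          rw [Finset.mem_range] at hk
          omega
      _ ≤ ∑ k ∈ Finset.range (N + 2 * (J + 1)), f k := by
          rw [show N + 2 * (J + 1) = N + 2 * J + 1 + 1 by ring, Finset.sum_range_succ',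
            Finset.sum_range_succ' _ (N + 2 * J)]
          have := hf 0
          have := hf (0 + 1)
          linarith

lemma beCoverProb_nonneg (n t : ℕ) : 0 ≤ beCoverProb n t := by
  unfold beCoverProb
  positivity

open Finset in
/-- The solvable configurations are among those with at most `t - n` even vertices. -/
lemma natCard_coverSolvable_le (n s : ℕ) :
    Nat.card {C : Fin n → ℕ // (∑ v, C v) = n + s ∧ CoverSolvable (⊤ : SimpleGraph (Fin n)) C} ≤
      ∑ k ∈ range (s + 1), #{C ∈ piAntidiag (univ : Finset (Fin n)) (n + s) | evenCount C = k} := by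
  have hsub : {C : Fin n → ℕ | (∑ v, C v) = n + s ∧ CoverSolvable (⊤ : SimpleGraph (Fin n)) C} ⊆
      ({C ∈ piAntidiag (univ : Finset (Fin n)) (n + s) | evenCount C ∈ range (s + 1)} :
        Finset (Fin n → ℕ)) := by
    rintro C ⟨hsum, hC⟩
    have := hC.card_add_evenCount_le
    rw [Fintype.card_fin] at this
    simp only [coe_filter, Set.mem_ofPred_eq, mem_piAntidiag, mem_range]
    exact ⟨⟨hsum, by simp⟩, by omega⟩
  calc _ ≤ #{C ∈ piAntidiag (univ : Finset (Fin n)) (n + s) | evenCount C ∈ range (s + 1)} := by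
        rw [← Set.ncard_coe_finset]
        exact Set.ncard_le_ncard hsub (finite_toSet _)
    _ = _ := by
        rw [card_eq_sum_card_fiberwise (f := evenCount) (t := range (s + 1))]
        · refine sum_congr rfl fun k hk => ?_
          congr 1
          ext C
          simp only [mem_filter]
          constructor
          · exact fun h => ⟨h.1.1, h.2⟩
          · exact fun h => ⟨⟨h.1, h.2 ▸ hk⟩, h.2⟩
        · intro C hC
          simp only [coe_filter, Set.mem_ofPred_eq] at hC
          exact hC.2

open Finset in
lemma sum_card_evenCount_le (n t N : ℕ) :
    ∑ k ∈ range N, #{C ∈ piAntidiag (univ : Finset (Fin n)) t | evenCount C = k} ≤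
      (n + t - 1).choose t := by
  calc _ = #((range N).biUnion fun k =>
        {C ∈ piAntidiag (univ : Finset (Fin n)) t | evenCount C = k}) := by
        refine (card_biUnion fun i _ j _ hij => ?_).symm
        exact disjoint_filter.2 fun C _ h₁ h₂ => hij (h₁.symm.trans h₂)
    _ ≤ #(piAntidiag (univ : Finset (Fin n)) t) :=
        card_le_card (biUnion_subset.2 fun k _ => filter_subset _ _)
    _ = _ := by simp [card_piAntidiag_nat_eq_choose]

lemma beCoverProb_eq_zero_of_lt {n t : ℕ} (h : t < n) : beCoverProb n t = 0 := by
  have : IsEmpty {C : Fin n → ℕ // (∑ v, C v) = t ∧ CoverSolvable (⊤ : SimpleGraph (Fin n)) C} := by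
    refine ⟨fun ⟨C, hsum, hC⟩ => ?_⟩
    have := hC.card_add_evenCount_le
    rw [Fintype.card_fin] at this
    omega
  simp [beCoverProb]

lemma one_add_mul_beCoverProb_le {g w : ℝ} {n s J : ℕ} (hg : g ^ 2 + g = 1) (hg0 : 0 < g)
    (hn : 1 ≤ n) (hw : 0 ≤ w) (h : s + 2 * J + 1 + w ≤ g * n) :
    (1 + J * (w / n)) * beCoverProb n (n + s) ≤ 1 := by
  have hr : 0 ≤ w / n := by positivity
  have hgrow := pow_mul_sum_range_le (N := s + 1) (J := J) (r := 1 + w / n)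
    (f := fun k => (((Finset.piAntidiag (Finset.univ : Finset (Fin n)) (n + s)).filter
        fun C => evenCount C = k).card : ℝ)) (fun k => Nat.cast_nonneg _) (by positivity)
    fun k hk => card_evenCount_growth hg hg0 hn hw (by omega) h
  have htotal : ((∑ k ∈ Finset.range (s + 1 + 2 * J),
      ((Finset.piAntidiag (Finset.univ : Finset (Fin n)) (n + s)).filter
        fun C => evenCount C = k).card : ℕ) : ℝ) ≤ ((n + (n + s) - 1).choose (n - 1) : ℕ) := by
    rw [Nat.choose_symm_of_eq_add (show n + (n + s) - 1 = (n - 1) + (n + s) by omega)]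
    exact_mod_cast sum_card_evenCount_le n (n + s) _
  have hsolv : (Nat.card {C : Fin n → ℕ // (∑ v, C v) = n + s ∧
      CoverSolvable (⊤ : SimpleGraph (Fin n)) C} : ℝ) ≤ _ :=
    Nat.cast_le.2 (natCard_coverSolvable_le n s)
  push_cast at htotal hsolv
  have hpos : (0 : ℝ) < ((n + (n + s) - 1).choose (n - 1) : ℕ) := by
    exact_mod_cast Nat.choose_pos (by omega)
  rw [beCoverProb, ← mul_div_assoc, div_le_one hpos]
  calc _ ≤ (1 + w / n) ^ J * _ :=
        mul_le_mul (one_add_mul_le_pow (by linarith) J) hsolv (Nat.cast_nonneg _) (by positivity)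
    _ ≤ _ := hgrow.trans htotal

/-- A quantitative form of the lower threshold. -/
lemma beCoverProb_le_of_le_sub {n t : ℕ} {x : ℝ} (hn : 1 ≤ n) (hx : 10 ≤ x)
    (ht : (t : ℝ) ≤ (1 + √5) / 2 * n - x * √n + 1) : beCoverProb n t ≤ 32 / x ^ 2 := by
  rcases lt_or_ge t n with hlt | hge
  · rw [beCoverProb_eq_zero_of_lt hlt]
    positivity
  obtain ⟨s, rfl⟩ := Nat.exists_eq_add_of_le hge
  push_cast at ht
  have h5 : √5 ^ 2 = 5 := Real.sq_sqrt (by norm_num)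
  have h5' : 1 < √5 := Real.lt_sqrt_of_sq_lt (by norm_num)
  set g : ℝ := (√5 - 1) / 2 with hg
  have hg1 : g ^ 2 + g = 1 := by rw [hg]; linear_combination h5 / 4
  have hg0 : 0 < g := by rw [hg]; linarith
  have hn1 : (1 : ℝ) ≤ √n := Real.one_le_sqrt.2 (by exact_mod_cast hn)
  have hnsq : √(n : ℝ) ^ 2 = n := Real.sq_sqrt (Nat.cast_nonneg _)
  have hn0 : (0 : ℝ) < n := by exact_mod_cast hn
  have hxn : 10 ≤ x * √n := by nlinarith
  set d : ℝ := g * n - s with hd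
  have hdx : x * √n - 1 ≤ d := by
    rw [hd, hg]
    linarith
  have hJ₁ : (⌊d / 4⌋₊ : ℝ) ≤ d / 4 := Nat.floor_le (by linarith)
  have hJ₂ : d / 4 < ⌊d / 4⌋₊ + 1 := Nat.lt_floor_add_one _
  have hmain := one_add_mul_beCoverProb_le (w := d / 2 - 1) (J := ⌊d / 4⌋₊) (s := s) hg1 hg0 hn
    (by linarith) (by linarith)
  have hp := beCoverProb_nonneg n (n + s)
  have hbound : x ^ 2 / 32 ≤ ⌊d / 4⌋₊ * ((d / 2 - 1) / n) := by
    rw [← mul_div_assoc, le_div_iff₀ hn0]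
    have h₁ : x * √n / 8 ≤ (⌊d / 4⌋₊ : ℝ) := by linarith
    have h₂ : x * √n / 4 ≤ d / 2 - 1 := by linarith
    calc x ^ 2 / 32 * n = x * √n / 8 * (x * √n / 4) := by
          linear_combination (-x ^ 2 / 32) * hnsq
      _ ≤ _ := mul_le_mul h₁ h₂ (by positivity) (Nat.cast_nonneg _)
  rw [le_div_iff₀ (by positivity)]
  nlinarith [mul_le_mul_of_nonneg_right hbound hp]

/-- Let `γ = (1+√5)/2` be the golden ratio and `φ(n) → ∞`.  If
`t(n) = γ·n − φ(n)·√n` (up to rounding), then the probability that a uniformly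
random Bose Einstein configuration of `t(n)` pebbles on `K_n` is cover solvable
tends to `0`. -/
theorem be_cover_threshold_lower (φ : ℕ → ℝ)
    (hφ : Filter.Tendsto φ Filter.atTop Filter.atTop) (t : ℕ → ℕ)
    (ht : ∀ n, |(t n : ℝ) - ((1 + Real.sqrt 5) / 2 * n - φ n * Real.sqrt n)| ≤ 1) :
    Filter.Tendsto (fun n => beCoverProb n (t n)) Filter.atTop (nhds 0) := by
  refine squeeze_zero' (Filter.Eventually.of_forall fun n => beCoverProb_nonneg n (t n)) ?_
    ((Filter.Tendsto.const_div_atTop ((Filter.tendsto_pow_atTop two_ne_zero).comp hφ)) 32)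
  filter_upwards [hφ.eventually_ge_atTop 10, Filter.eventually_ge_atTop 1] with n hx hn
  refine beCoverProb_le_of_le_sub hn hx ?_
  linarith [(abs_le.1 (ht n)).2]
end

section
/- Let G be a finite graph with vertices v_1, ..., v_m and let C be a configuration on G. Then C is cover solvable if and only if there exist nonnegative integers n_{ij} (1 ≤ i, j ≤ m) with n_{ij} = 0 and n_{ji} = 0 whenever {v_i, v_j} is not an edge of G, such that for all 1 ≤ k ≤ m: C(v_k) + ∑_{l=1}^m n_{lk} − 2·∑_{l=1}^m n_{kl} ≥ 1. -/
/-- The number of pebbles at `k` after making `nm i j` moves from `i` to `j` for all `i`, `j`,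
starting from `C` and ignoring feasibility. -/
def flowBalance {V : Type*} [Fintype V] (C : V → ℕ) (nm : V → V → ℕ) (k : V) : ℤ :=
  (C k : ℤ) + ∑ l : V, (nm l k : ℤ) - 2 * ∑ l : V, (nm k l : ℤ)

/-- Adding the move `u → v` to a flow has the same effect as performing it first. -/
theorem flowBalance_add_move {V : Type*} [Fintype V] [DecidableEq V] (C : V → ℕ)
    (nm : V → V → ℕ) {u v : V} (huv : u ≠ v) (hu : 2 ≤ C u) (k : V) :
    flowBalance C (fun i j => nm i j + if i = u ∧ j = v then 1 else 0) k =
      flowBalance (Function.update (Function.update C u (C u - 2)) v (C v + 1)) nm k := by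
  have hin : ∑ l : V, (if l = u ∧ k = v then (1 : ℤ) else 0) = if k = v then 1 else 0 := by
    simp [ite_and]
  have hout : ∑ l : V, (if k = u ∧ l = v then (1 : ℤ) else 0) = if k = u then 1 else 0 := by
    simp [ite_and]
  simp only [flowBalance, Nat.cast_add, Nat.cast_ite, Nat.cast_one, Nat.cast_zero,
    Finset.sum_add_distrib, hin, hout, Function.update_apply]
  split_ifs with hv hu' <;> subst_vars <;> first | contradiction | (push_cast [hu]; ring)

/-- If a nonzero flow keeps every balance positive, some vertex that sends a pebble along the flow
already carries two pebbles. -/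
theorem exists_feasible_move {V : Type*} [Fintype V] {C : V → ℕ} {nm : V → V → ℕ}
    (hpos : ∀ k, 1 ≤ flowBalance C nm k) (hne : ∑ i, ∑ j, nm i j ≠ 0) :
    ∃ u v, nm u v ≠ 0 ∧ 2 ≤ C u := by
  by_contra! h
  have hle : ∀ k, 2 * ∑ l, nm k l ≤ ∑ l, nm l k := by
    intro k
    by_cases hk : ∑ l, nm k l = 0
    · simp [hk]
    · obtain ⟨v, -, hv⟩ := Finset.exists_ne_zero_of_sum_ne_zero hk
      have hC := h k v hv
      have hb := hpos k
      simp only [flowBalance] at hb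
      zify
      omega
  have hsum := Finset.sum_le_sum fun k (_ : k ∈ Finset.univ) => hle k
  rw [← Finset.mul_sum, Finset.sum_comm (f := fun k l => nm l k)] at hsum
  omega

theorem CoverSolvable.exists_flow {V : Type*} [Fintype V] [DecidableEq V] {G : SimpleGraph V}
    {C : V → ℕ} (h : CoverSolvable G C) :
    ∃ nm : V → V → ℕ, (∀ i j, ¬ G.Adj i j → nm i j = 0) ∧ ∀ k, 1 ≤ flowBalance C nm k := by
  obtain ⟨C', hmoves, hcover⟩ := h
  induction hmoves using Relation.ReflTransGen.head_induction_on with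
  | refl => exact ⟨0, by simp, by simpa [flowBalance] using hcover⟩
  | head hmove _ ih =>
    obtain ⟨u, v, hadj, hu, rfl⟩ := hmove
    obtain ⟨nm, hsupp, hpos⟩ := ih
    refine ⟨fun i j => nm i j + if i = u ∧ j = v then 1 else 0, fun i j hij => ?_, fun k => ?_⟩
    · have hne : ¬ (i = u ∧ j = v) := by
        rintro ⟨rfl, rfl⟩
        exact hij hadj
      simp [hsupp i j hij, hne]
    · rw [flowBalance_add_move _ nm hadj.ne hu]
      exact hpos k

theorem coverSolvable_of_flow {V : Type*} [Fintype V] [DecidableEq V] {G : SimpleGraph V}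
    {C : V → ℕ} {nm : V → V → ℕ} (hsupp : ∀ i j, ¬ G.Adj i j → nm i j = 0)
    (hpos : ∀ k, 1 ≤ flowBalance C nm k) : CoverSolvable G C := by
  induction hN : ∑ i, ∑ j, nm i j generalizing C nm with
  | zero =>
    have hzero : ∀ i j, nm i j = 0 := by simpa [Finset.sum_eq_zero_iff] using hN
    exact ⟨C, .refl, by simpa [flowBalance, hzero] using hpos⟩
  | succ N ih =>
    obtain ⟨u, v, huv, hu⟩ := exists_feasible_move hpos (by omega)
    have hadj : G.Adj u v := by
      by_contra hn
      exact huv (hsupp u v hn)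
    obtain ⟨nm', rfl⟩ :
        ∃ nm' : V → V → ℕ, nm = fun i j => nm' i j + if i = u ∧ j = v then 1 else 0 := by
      refine ⟨fun i j => nm i j - if i = u ∧ j = v then 1 else 0, ?_⟩
      funext i j
      by_cases hij : i = u ∧ j = v
      · obtain ⟨rfl, rfl⟩ := hij
        simp only [and_self, if_true]
        omega
      · simp [hij]
    have hcount : ∑ i, ∑ j, nm' i j = N := by
      simpa [Finset.sum_add_distrib, ite_and] using hN
    obtain ⟨C', hmoves, hcover⟩ :=
      ih (C := Function.update (Function.update C u (C u - 2)) v (C v + 1))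
        (fun i j hij => (Nat.add_eq_zero_iff.mp (hsupp i j hij)).1)
        (fun k => flowBalance_add_move C nm' hadj.ne hu k ▸ hpos k) hcount
    exact ⟨C', hmoves.head ⟨u, v, hadj, hu, rfl⟩, hcover⟩

/-- A configuration `C` on a finite graph `G` is cover solvable if and only if
there exist nonnegative integers `n i j` (interpreted as the number of pebbling
moves from vertex `i` to vertex `j`), vanishing whenever `{i, j}` is not an edge
of `G`, such that for every vertex `k`,
`C k + ∑_l n l k − 2·∑_l n k l ≥ 1`. -/
theorem coverSolvable_iff_flow {V : Type*} [Fintype V] [DecidableEq V]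
    (G : SimpleGraph V) (C : V → ℕ) :
    CoverSolvable G C ↔
      ∃ nm : V → V → ℕ,
        (∀ i j : V, ¬ G.Adj i j → nm i j = 0) ∧
        ∀ k : V, 1 ≤ (C k : ℤ) + ∑ l : V, (nm l k : ℤ) - 2 * ∑ l : V, (nm k l : ℤ) := by
  exact ⟨fun h => h.exists_flow, fun ⟨_, hsupp, hpos⟩ => coverSolvable_of_flow hsupp hpos⟩
end

section
/- Let S = {s_1, ..., s_{4n}} be a set with 4n elements and A = {a_1, ..., a_m} a family of 4-element subsets of S with m ≥ n. Construct the graph G' and configuration C' as follows: take vertices T = {t_1, ..., t_{4n}} (one per element of S), B = {b_1, ..., b_m} (one per member of A), with an edge {b_i, t_j} whenever s_j ∈ a_i; a path of length m−n from a vertex v to a vertex w; and vertex sets B' = {b_1', ..., b_m'}, B'' = {b_1'', ..., b_m''} with edges {b_i, b_i'}, {b_i', b_i''}, {b_i'', v} for all i. Set C'(t) = 0 for all t ∈ T, C'(b) = 9 for all b ∈ B, C'(v) = 2^{m−n} − (m−n) + 1, C'(w) = 0, C'(u) = 1 for every internal vertex u of the path between v and w, and C'(u) = 1 for all u ∈ B'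 ∪ B''. Then C' is cover solvable on G' if and only if A contains an exact cover of S, i.e., a subfamily of n pairwise disjoint members of A whose union is S. -/
/-- The vertex set of the graph `G'` built from an instance of exact cover by
4-sets: in order, the vertices `T = {t_1, …, t_{4n}}` (one per element of `S`),
`B = {b_1, …, b_m}` (one per member of `A`), `B' = {b_1', …, b_m'}`,
`B'' = {b_1'', …, b_m''}`, and the `m − n + 1` vertices of a path of length
`m − n` whose first vertex (index `0`) is `v` and whose last vertex (index
`m − n`) is `w`. -/
abbrev CoverVtx (n m : ℕ) : Type :=
  Fin (4 * n) ⊕ (Fin m ⊕ (Fin m ⊕ (Fin m ⊕ Fin (m - n + 1))))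

/-- The base adjacency relation of `G'`: `t_j ∼ b_i` iff `s_j ∈ a_i`;
`b_i ∼ b_i'`; `b_i' ∼ b_i''`; `b_i'' ∼ v`; and consecutive path vertices are
adjacent. -/
def coverRel (n m : ℕ) (a : Fin m → Finset (Fin (4 * n))) :
    CoverVtx n m → CoverVtx n m → Prop := fun x y =>
  match x, y with
  | Sum.inl j, Sum.inr (Sum.inl i) => j ∈ a i
  | Sum.inr (Sum.inl i), Sum.inr (Sum.inr (Sum.inl i')) => i = i'
  | Sum.inr (Sum.inr (Sum.inl i)), Sum.inr (Sum.inr (Sum.inr (Sum.inl i'))) => i = i'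
  | Sum.inr (Sum.inr (Sum.inr (Sum.inl _))), Sum.inr (Sum.inr (Sum.inr (Sum.inr k))) =>
      (k : ℕ) = 0
  | Sum.inr (Sum.inr (Sum.inr (Sum.inr k))), Sum.inr (Sum.inr (Sum.inr (Sum.inr k'))) =>
      (k' : ℕ) = (k : ℕ) + 1
  | _, _ => False

/-- The graph `G'` constructed from the instance `(S, A)` of exact cover by
4-sets. -/
def coverGraph (n m : ℕ) (a : Fin m → Finset (Fin (4 * n))) : SimpleGraph (CoverVtx n m) :=
  SimpleGraph.fromRel (coverRel n m a)

/-- The configuration `C'` on `G'`: `0` pebbles on each vertex of `T`, `9` on each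
vertex of `B`, `1` on each vertex of `B' ∪ B''`, `2^{m−n} − (m−n) + 1` on `v`,
`0` on `w`, and `1` on each internal vertex of the path from `v` to `w`. -/
def coverConfig (n m : ℕ) : CoverVtx n m → ℕ
  | Sum.inl _ => 0
  | Sum.inr (Sum.inl _) => 9
  | Sum.inr (Sum.inr (Sum.inl _)) => 1
  | Sum.inr (Sum.inr (Sum.inr (Sum.inl _))) => 1
  | Sum.inr (Sum.inr (Sum.inr (Sum.inr k))) =>
      if (k : ℕ) = 0 then 2 ^ (m - n) - (m - n) + 1
      else if (k : ℕ) = m - n then 0 else 1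

/-- Pebbling moves from `C` to `C'`, recorded by the number `f u x` of moves along each ordered
pair `(u, x)`, satisfy the pebble balance at every vertex. -/
theorem exists_flow_of_reachable {V : Type*} [Fintype V] [DecidableEq V] {G : SimpleGraph V}
    {C C' : V → ℕ} (h : Relation.ReflTransGen (PebblingMove G) C C') :
    ∃ f : V → V → ℕ, (∀ u x, f u x ≠ 0 → G.Adj u x) ∧
      ∀ u, C' u + 2 * ∑ x, f u x = C u + ∑ x, f x u := by
  induction h with
  | refl => exact ⟨fun _ _ => 0, by simp, by simp⟩
  | @tail D E _ hDE ih =>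
    obtain ⟨f, hf, hbal⟩ := ih
    obtain ⟨a, b, hab, h2, rfl⟩ := hDE
    refine ⟨fun u x => f u x + if u = a ∧ x = b then 1 else 0, ?_, ?_⟩
    · intro u x hux
      by_cases hc : u = a ∧ x = b
      · rw [hc.1, hc.2]; exact hab
      · exact hf u x (by simpa [hc] using hux)
    · intro u
      have hu := hbal u
      have hne := hab.ne
      simp only [Finset.sum_add_distrib]
      have h₁ : ∑ x, (if u = a ∧ x = b then 1 else 0) = if u = a then 1 else 0 := by
        by_cases h : u = a <;> simp [h]
      have h₂ : ∑ x, (if x = a ∧ u = b then 1 else 0) = if u = b then 1 else 0 := by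
        by_cases h : u = b <;> simp [h]
      rw [h₁, h₂]
      by_cases hua : u = a
      · subst hua
        simp [hne]
        omega
      · by_cases hub : u = b
        · subst hub
          simp [hua]
          omega
        · simpa [hua, hub] using hu

/-- The weighted form of the balance equations: the total weight drops by the losses of the
individual moves. -/
theorem weight_add_loss_eq {V : Type*} [Fintype V] {C C' : V → ℕ} {f : V → V → ℕ} {w : V → ℕ}
    (hbal : ∀ u, C' u + 2 * ∑ x, f u x = C u + ∑ x, f x u)
    (hw : ∀ u x, f u x ≠ 0 → w x ≤ 2 * w u) :
    ∑ u, w u * C' u + ∑ u, ∑ x, f u x * (2 * w u - w x) = ∑ u, w u * C u := by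
  have h₁ : ∑ u, w u * C' u + ∑ u, ∑ x, f u x * (2 * w u) =
      ∑ u, w u * C u + ∑ u, ∑ x, f u x * w x := by
    rw [Finset.sum_comm (f := fun u x => f u x * w x), ← Finset.sum_add_distrib,
      ← Finset.sum_add_distrib]
    refine Finset.sum_congr rfl fun u _ => ?_
    rw [← Finset.sum_mul, ← Finset.sum_mul]
    linear_combination w u * hbal u
  have h₂ : ∑ u, ∑ x, f u x * (2 * w u) =
      ∑ u, ∑ x, f u x * (2 * w u - w x) + ∑ u, ∑ x, f u x * w x := by
    simp only [← Finset.sum_add_distrib]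
    refine Finset.sum_congr rfl fun u _ => Finset.sum_congr rfl fun x _ => ?_
    by_cases h : f u x = 0
    · simp [h]
    · rw [← mul_add, Nat.sub_add_cancel (hw u x h)]
  omega

section Reachability

variable {V : Type*} [DecidableEq V] {G : SimpleGraph V}

theorem reachable_add_right {C C' : V → ℕ} (D : V → ℕ)
    (h : Relation.ReflTransGen (PebblingMove G) C C') :
    Relation.ReflTransGen (PebblingMove G) (C + D) (C' + D) := by
  refine Relation.ReflTransGen.lift (· + D) ?_ _ _ h
  rintro A _ ⟨u, v, huv, h2, rfl⟩
  refine ⟨u, v, huv, by simp only [Pi.add_apply]; omega, ?_⟩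
  funext x
  by_cases hxv : x = v
  · subst hxv
    simp
    omega
  · by_cases hxu : x = u
    · subst hxu
      simp [hxv]
      omega
    · simp [hxv, hxu]

theorem reachable_add {A A' B B' : V → ℕ} (hA : Relation.ReflTransGen (PebblingMove G) A A')
    (hB : Relation.ReflTransGen (PebblingMove G) B B') :
    Relation.ReflTransGen (PebblingMove G) (A + B) (A' + B') := by
  refine (reachable_add_right B hA).trans ?_
  rw [add_comm A' B, add_comm A' B']
  exact reachable_add_right A' hB

theorem reachable_sum {ι : Type*} (s : Finset ι) {A B : ι → V → ℕ}
    (h : ∀ i ∈ s, Relation.ReflTransGen (PebblingMove G) (A i) (B i)) :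
    Relation.ReflTransGen (PebblingMove G) (∑ i ∈ s, A i) (∑ i ∈ s, B i) := by
  classical
  induction s using Finset.induction_on with
  | empty => simpa using Relation.ReflTransGen.refl
  | insert i s hi ih =>
    rw [Finset.sum_insert hi, Finset.sum_insert hi]
    exact reachable_add (h i (Finset.mem_insert_self i s))
      (ih fun j hj => h j (Finset.mem_insert_of_mem hj))

theorem reachable_nsmul {A B : V → ℕ} (c : ℕ)
    (h : Relation.ReflTransGen (PebblingMove G) A B) :
    Relation.ReflTransGen (PebblingMove G) (c • A) (c • B) := by
  simpa using reachable_sum (Finset.range c) (A := fun _ => A) (B := fun _ => B) fun _ _ => h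

theorem reachable_single {u v : V} (h : G.Adj u v) :
    Relation.ReflTransGen (PebblingMove G) (2 • Pi.single u 1) (Pi.single v 1) := by
  refine Relation.ReflTransGen.single ⟨u, v, h, by simp, ?_⟩
  have hne := h.ne
  funext x
  by_cases hxv : x = v
  · subst hxv
    simp [hne.symm]
  · by_cases hxu : x = u
    · subst hxu
      simp [hxv]
    · simp [hxv, hxu]

theorem reachable_two_mul {u v : V} (h : G.Adj u v) (c : ℕ) :
    Relation.ReflTransGen (PebblingMove G) ((2 * c) • Pi.single u 1) (c • Pi.single v 1) := by
  rw [mul_comm, mul_smul]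
  exact reachable_nsmul c (reachable_single h)

end Reachability

namespace CoverVtx

variable {n m : ℕ}

/-- The vertex `t_j`. -/
abbrev elt (j : Fin (4 * n)) : CoverVtx n m := Sum.inl j

/-- The vertex `b_i`. -/
abbrev fam (i : Fin m) : CoverVtx n m := Sum.inr (Sum.inl i)

/-- The vertex `b_i'`. -/
abbrev fam' (i : Fin m) : CoverVtx n m := Sum.inr (Sum.inr (Sum.inl i))

/-- The vertex `b_i''`. -/
abbrev fam'' (i : Fin m) : CoverVtx n m := Sum.inr (Sum.inr (Sum.inr (Sum.inl i)))

/-- The vertices of the path from `v` to `w`. -/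
abbrev path (k : Fin (m - n + 1)) : CoverVtx n m := Sum.inr (Sum.inr (Sum.inr (Sum.inr k)))

end CoverVtx

open CoverVtx

/-- A weight on the vertices of `G'` that no pebbling move increases. -/
def coverWeight (n m : ℕ) : CoverVtx n m → ℕ
  | Sum.inl _ => 2
  | Sum.inr (Sum.inl _) => 1
  | Sum.inr (Sum.inr (Sum.inl _)) => 2
  | Sum.inr (Sum.inr (Sum.inr (Sum.inl _))) => 4
  | Sum.inr (Sum.inr (Sum.inr (Sum.inr k))) => 8 * 2 ^ (k : ℕ)

/-- The final configuration forced by the weight: one pebble everywhere, and an additional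
one on `v` if `v = w`. -/
def coverTarget (n m : ℕ) : CoverVtx n m → ℕ
  | Sum.inr (Sum.inr (Sum.inr (Sum.inr _))) => if m - n = 0 then 2 else 1
  | _ => 1

theorem coverWeight_pos {n m : ℕ} (u : CoverVtx n m) : 0 < coverWeight n m u := by
  rcases u with j | i | i | i | k <;> simp [coverWeight]

theorem coverWeight_le_of_adj {n m : ℕ} {a : Fin m → Finset (Fin (4 * n))} {u x : CoverVtx n m}
    (h : (coverGraph n m a).Adj u x) : coverWeight n m x ≤ 2 * coverWeight n m u := by
  rcases u with j | i | i | i | k <;> rcases x with j' | i' | i' | i' | k' <;>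
    simp_all [coverGraph, coverRel, coverWeight]
  rcases h with ⟨_, h | h⟩ <;> rw [h, pow_succ] <;> omega

theorem sum_path_weight (K : ℕ) :
    ∑ k : Fin (K + 1), 8 * 2 ^ (k : ℕ) *
        (if (k : ℕ) = 0 then 2 ^ K - K + 1 else if (k : ℕ) = K then 0 else 1) + 8 * K =
      ∑ k : Fin (K + 1), 8 * 2 ^ (k : ℕ) * (if K = 0 then 2 else 1) := by
  rcases K with _ | K
  · simp
  · rw [Fin.sum_univ_succ, Fin.sum_univ_succ (n := K + 1), Fin.sum_univ_castSucc,
      Fin.sum_univ_castSucc (n := K)]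
    have h : K + 1 ≤ 2 ^ (K + 1) := Nat.lt_two_pow_self.le
    have h' : ∀ x : Fin K, (x : ℕ) ≠ K := fun x => x.2.ne
    simp [h']
    omega

theorem sum_coverWeight_mul_coverConfig {n m : ℕ} (hm : n ≤ m) :
    ∑ u, coverWeight n m u * coverConfig n m u =
      ∑ u, coverWeight n m u * coverTarget n m u := by
  have h := sum_path_weight (m - n)
  simp only [Fintype.sum_sum_type, coverWeight, coverConfig, coverTarget, Finset.sum_const,
    Finset.card_univ, Fintype.card_fin, smul_eq_mul]
  omega

/-- The recorded moves of a sequence solving `C'` are exactly balanced with respect to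
`coverTarget`, and none of them loses weight. -/
theorem exists_tight_flow {n m : ℕ} (hm : n ≤ m) {a : Fin m → Finset (Fin (4 * n))}
    (h : CoverSolvable (coverGraph n m a) (coverConfig n m)) :
    ∃ f : CoverVtx n m → CoverVtx n m → ℕ,
      (∀ u x, f u x ≠ 0 →
        (coverGraph n m a).Adj u x ∧ 2 * coverWeight n m u ≤ coverWeight n m x) ∧
      ∀ u, coverTarget n m u + 2 * ∑ x, f u x = coverConfig n m u + ∑ x, f x u := by
  obtain ⟨C', hC', hpos⟩ := h
  obtain ⟨f, hf, hbal⟩ := exists_flow_of_reachable hC'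
  have hw := weight_add_loss_eq (w := coverWeight n m) hbal
    fun u x hux => coverWeight_le_of_adj (hf u x hux)
  rw [sum_coverWeight_mul_coverConfig hm] at hw
  have hloss : ∀ u x, f u x * (2 * coverWeight n m u - coverWeight n m x) ≤
      ∑ u, ∑ x, f u x * (2 * coverWeight n m u - coverWeight n m x) := fun u x =>
    (Finset.single_le_sum (f := fun x => f u x * (2 * coverWeight n m u - coverWeight n m x))
      (fun _ _ => Nat.zero_le _) (Finset.mem_univ x)).trans
    (Finset.single_le_sum
      (f := fun u => ∑ x, f u x * (2 * coverWeight n m u - coverWeight n m x))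
      (fun _ _ => Nat.zero_le _) (Finset.mem_univ u))
  have hge : ∀ u, coverTarget n m u ≤ C' u := by
    rintro (j | i | i | i | k)
    · exact hpos _
    · exact hpos _
    · exact hpos _
    · exact hpos _
    simp only [coverTarget]
    split_ifs with hK
    · by_contra hlt
      have hk : (k : ℕ) = 0 := by omega
      have hb := hbal (path k)
      have hc : coverConfig n m (path k) = 2 := by simp [coverConfig, hk, hK]
      have hC' : C' (path k) < 2 := not_le.1 hlt
      have hsum : ∑ x, f (path k) x ≠ 0 := by
        intro h0
        rw [h0, hc] at hb
        omega
      obtain ⟨x, -, hx⟩ := Finset.exists_ne_zero_of_sum_ne_zero hsum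
      have hl : 12 ≤ f (path k) x *
          (2 * coverWeight n m (path k) - coverWeight n m x) := by
        have hadj := hf _ _ hx
        have : 12 ≤ 2 * coverWeight n m (path k) - coverWeight n m x := by
          rcases x with j' | i' | i' | i' | k'
          · simp [coverGraph, coverRel] at hadj
          · simp [coverGraph, coverRel] at hadj
          · simp [coverGraph, coverRel] at hadj
          · simp [coverWeight, hk]
          · exact absurd (congrArg path (Fin.ext (by omega))) hadj.ne
        nlinarith [Nat.pos_of_ne_zero hx]
      have hsmall : ∑ u, coverWeight n m u * coverTarget n m u ≤
          ∑ u, coverWeight n m u * C' u + 8 := by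
        have h8 : ∑ u : CoverVtx n m, (if u = path k then 8 else 0) = 8 := by simp
        rw [← h8, ← Finset.sum_add_distrib]
        refine Finset.sum_le_sum fun u _ => ?_
        have hu := hpos u
        rcases u with j | i | i | i | l
        · simpa [coverTarget, coverWeight] using hu
        · simpa [coverTarget, coverWeight] using hu
        · simpa [coverTarget, coverWeight] using hu
        · simpa [coverTarget, coverWeight] using hu
        · have hl0 : (l : ℕ) = 0 := by omega
          have : l = k := by ext; omega
          subst this
          simp only [coverTarget, coverWeight, hK, hl0, if_true]
          omega
      have := hloss (path k) x
      omega
    · exact hpos _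
  have hsum_le : ∑ u, coverWeight n m u * coverTarget n m u ≤ ∑ u, coverWeight n m u * C' u :=
    Finset.sum_le_sum fun u _ => Nat.mul_le_mul_left _ (hge u)
  have heq : ∀ u, coverTarget n m u = C' u := by
    have := (Finset.sum_eq_sum_iff_of_le
      fun u _ => Nat.mul_le_mul_left (coverWeight n m u) (hge u)).1
      (show ∑ u, coverWeight n m u * coverTarget n m u = ∑ u, coverWeight n m u * C' u by omega)
    exact fun u => Nat.eq_of_mul_eq_mul_left (coverWeight_pos u) (this u (Finset.mem_univ u))
  refine ⟨f, fun u x hux => ⟨hf u x hux, ?_⟩, fun u => by rw [heq u]; exact hbal u⟩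
  have h0 : f u x * (2 * coverWeight n m u - coverWeight n m x) = 0 := by
    have := hloss u x
    omega
  rcases Nat.mul_eq_zero.1 h0 with h0 | h0
  · exact absurd h0 hux
  · omega

theorem exists_exactCover_of_coverSolvable {n m : ℕ} (hm : n ≤ m)
    {a : Fin m → Finset (Fin (4 * n))} (ha4 : ∀ i, (a i).card = 4)
    (h : CoverSolvable (coverGraph n m a) (coverConfig n m)) :
    ∃ I : Finset (Fin m), I.card = n ∧
      (∀ i ∈ I, ∀ j ∈ I, i ≠ j → Disjoint (a i) (a j)) ∧
      I.biUnion a = Finset.univ := by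
  obtain ⟨f, hf, hbal⟩ := exists_tight_flow hm h
  have hz : ∀ u x, ¬((coverGraph n m a).Adj u x ∧
      2 * coverWeight n m u ≤ coverWeight n m x) → f u x = 0 :=
    fun u x hn => by_contra fun h0 => hn (hf u x h0)
  have helt : ∀ j, ∑ i, f (fam i) (elt j) = 1 := by
    intro j
    have hb := hbal (elt j)
    have h₁ : ∀ j x, f (elt j) x = 0 := fun j x => hz _ _ <| by
      rcases x with _ | _ | _ | _ | _ <;> simp [coverGraph, coverRel, coverWeight]
    have h₂ : ∀ x, f (Sum.inr (Sum.inr x)) (elt j) = 0 := fun x => hz _ _ <| by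
      rcases x with _ | _ | _ <;> simp [coverGraph, coverRel]
    have h₃ : ∑ x, f x (elt j) = ∑ i, f (fam i) (elt j) := by
      have h₄ : ∀ j', f (Sum.inl j') (elt j) = 0 := fun j' => h₁ _ _
      simp [Fintype.sum_sum_type, h₂, h₄]
    rw [h₃] at hb
    simp only [h₁, coverTarget, coverConfig, Finset.sum_const_zero] at hb
    omega
  have hfam : ∀ i, ∑ j, f (fam i) (elt j) + f (fam i) (fam' i) = 4 := by
    intro i
    have hb := hbal (fam i)
    have h₁ : ∀ x, f x (fam i) = 0 := fun x => hz _ _ <| by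
      rcases x with _ | _ | _ | _ | _ <;> simp [coverGraph, coverRel, coverWeight]
    have h₂ : ∀ i', f (fam i) (fam i') = 0 := fun i' => hz _ _ <| by
      simp [coverGraph, coverRel]
    have h₃ : ∀ x, f (fam i) (Sum.inr (Sum.inr (Sum.inr x))) = 0 := fun x => hz _ _ <| by
      rcases x with _ | _ <;> simp [coverGraph, coverRel]
    have h₄ : ∑ i', f (fam i) (fam' i') = f (fam i) (fam' i) :=
      Finset.sum_eq_single_of_mem i (Finset.mem_univ i) fun i' _ hi' => hz _ _ <| by
        simp [coverGraph, coverRel, hi'.symm]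
    have h₅ : ∑ x, f (fam i) x = ∑ j, f (fam i) (elt j) + f (fam i) (fam' i) := by
      simp [Fintype.sum_sum_type, h₂, h₃, h₄]
    rw [h₅] at hb
    simp only [h₁, coverTarget, coverConfig, Finset.sum_const_zero] at hb
    omega
  have hfam' : ∀ i, 2 * f (fam' i) (fam'' i) = f (fam i) (fam' i) := by
    intro i
    have hb := hbal (fam' i)
    have h₁ : ∑ x, f (fam' i) x = f (fam' i) (fam'' i) :=
      Finset.sum_eq_single_of_mem _ (Finset.mem_univ _) fun x _ hx => hz _ _ <| by
        revert hx
        rcases x with _ | _ | _ | _ | _ <;>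
          simp +contextual [coverGraph, coverRel, coverWeight, eq_comm]
    have h₂ : ∑ x, f x (fam' i) = f (fam i) (fam' i) :=
      Finset.sum_eq_single_of_mem _ (Finset.mem_univ _) fun x _ hx => hz _ _ <| by
        revert hx
        rcases x with _ | _ | _ | _ | _ <;>
          simp +contextual [coverGraph, coverRel, coverWeight, eq_comm]
    rw [h₁, h₂] at hb
    simp only [coverTarget, coverConfig] at hb
    omega
  have hfam'' : ∀ i, 2 ∣ f (fam' i) (fam'' i) := by
    intro i
    have hb := hbal (fam'' i)
    have h₂ : ∑ x, f x (fam'' i) = f (fam' i) (fam'' i) :=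
      Finset.sum_eq_single_of_mem _ (Finset.mem_univ _) fun x _ hx => hz _ _ <| by
        revert hx
        rcases x with _ | _ | _ | _ | k
        · simp [coverGraph, coverRel]
        · simp [coverGraph, coverRel]
        · simp +contextual [coverGraph, coverRel, eq_comm]
        · simp [coverGraph, coverRel]
        · have : 1 ≤ 2 ^ (k : ℕ) := Nat.one_le_two_pow
          simp only [coverWeight]
          omega
    rw [h₂] at hb
    simp only [coverTarget, coverConfig] at hb
    omega
  have hmem : ∀ i j, f (fam i) (elt j) ≠ 0 → j ∈ a i := fun i j hij => by
    simpa [coverGraph, coverRel] using (hf _ _ hij).1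
  have hle : ∀ i j, f (fam i) (elt j) ≤ 1 := fun i j => by
    rw [← helt j]
    exact Finset.single_le_sum (f := fun i => f (fam i) (elt j)) (fun _ _ => Nat.zero_le _)
      (Finset.mem_univ i)
  have hone : ∀ i, f (fam i) (fam' i) = 0 → ∀ j ∈ a i, f (fam i) (elt j) = 1 := by
    intro i hi
    have hsum : ∑ j ∈ a i, f (fam i) (elt j) = ∑ _j ∈ a i, 1 := by
      rw [Finset.sum_subset (Finset.subset_univ (a i))
        fun j _ hj => by_contra fun h0 => hj (hmem i j h0)]
      have := hfam i
      simp only [Finset.sum_const, ha4, smul_eq_mul]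
      omega
    exact (Finset.sum_eq_sum_iff_of_le fun j _ => hle i j).1 hsum
  have hdisj : ∀ i, f (fam i) (fam' i) = 0 → ∀ i', f (fam i') (fam' i') = 0 → i ≠ i' →
      Disjoint (a i) (a i') := by
    intro i hi i' hi' hne
    rw [Finset.disjoint_left]
    intro j hj hj'
    have hpair := Finset.sum_le_sum_of_subset (f := fun i => f (fam i) (elt j))
      (Finset.subset_univ {i, i'})
    rw [Finset.sum_pair hne, helt, hone i hi j hj, hone i' hi' j hj'] at hpair
    omega
  have hcover : (Finset.univ.filter fun i => f (fam i) (fam' i) = 0).biUnion a =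
      Finset.univ := by
    refine Finset.eq_univ_of_forall fun j => ?_
    obtain ⟨i, -, hi⟩ := Finset.exists_ne_zero_of_sum_ne_zero
      (show ∑ i, f (fam i) (elt j) ≠ 0 by rw [helt]; exact one_ne_zero)
    refine Finset.mem_biUnion.2 ⟨i, Finset.mem_filter.2 ⟨Finset.mem_univ i, ?_⟩, hmem i j hi⟩
    have hj : f (fam i) (elt j) ≤ ∑ j, f (fam i) (elt j) :=
      Finset.single_le_sum (f := fun j => f (fam i) (elt j)) (fun _ _ => Nat.zero_le _)
        (Finset.mem_univ j)
    have h₁ := hfam i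
    have h₂ := hfam' i
    have h₃ := hfam'' i
    omega
  have hdisj' : ∀ i ∈ Finset.univ.filter (fun i => f (fam i) (fam' i) = 0),
      ∀ i' ∈ Finset.univ.filter (fun i => f (fam i) (fam' i) = 0), i ≠ i' →
        Disjoint (a i) (a i') := fun i hi i' hi' =>
    hdisj i (Finset.mem_filter.1 hi).2 i' (Finset.mem_filter.1 hi').2
  refine ⟨_, ?_, hdisj', hcover⟩
  have hcard := Finset.card_biUnion hdisj'
  rw [hcover, Finset.sum_congr rfl fun i _ => ha4 i] at hcard
  simp only [Finset.card_univ, Fintype.card_fin, Finset.sum_const, smul_eq_mul] at hcard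
  omega

theorem reachable_path {n m : ℕ} (a : Fin m → Finset (Fin (4 * n))) (k : ℕ)
    (hk : k < m - n + 1) :
    Relation.ReflTransGen (PebblingMove (coverGraph n m a))
      (2 ^ k • Pi.single (path 0) 1) (Pi.single (path ⟨k, hk⟩) 1) := by
  induction k with
  | zero => simpa using Relation.ReflTransGen.refl
  | succ k ih =>
    rw [pow_succ', mul_smul]
    exact (reachable_nsmul 2 (ih (by omega))).trans
      (reachable_single (by simp [coverGraph, coverRel]))

theorem coverSolvable_of_exactCover {n m : ℕ} {a : Fin m → Finset (Fin (4 * n))}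
    (ha4 : ∀ i, (a i).card = 4) {I : Finset (Fin m)} (hcard : I.card = n)
    (hcover : I.biUnion a = Finset.univ) :
    CoverSolvable (coverGraph n m a) (coverConfig n m) := by
  have hin : ∀ i ∈ I, Relation.ReflTransGen (PebblingMove (coverGraph n m a))
      (8 • Pi.single (fam i) 1) (∑ j ∈ a i, Pi.single (elt j) 1) := by
    intro i _
    have := reachable_sum (G := coverGraph n m a) (a i)
      (A := fun _ => 2 • Pi.single (fam i) 1) (B := fun j => Pi.single (elt j) 1)
      fun j hj => reachable_single (by simpa [coverGraph, coverRel] using hj)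
    rwa [Finset.sum_const, ha4, ← mul_smul] at this
  have hout : ∀ i ∈ Iᶜ, Relation.ReflTransGen (PebblingMove (coverGraph n m a))
      (8 • Pi.single (fam i) 1) (1 • Pi.single (path 0) 1) := by
    intro i _
    exact ((reachable_two_mul (v := fam' i) (by simp [coverGraph, coverRel]) 4).trans
      (reachable_two_mul (v := fam'' i) (by simp [coverGraph, coverRel]) 2)).trans
      (reachable_two_mul (by simp [coverGraph, coverRel]) 1)
  have hfam := reachable_add (reachable_sum I hin) (reachable_sum Iᶜ hout)
  rw [Finset.sum_add_sum_compl, Finset.sum_const, Finset.card_compl, hcard, Fintype.card_fin,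
    one_smul] at hfam
  have hv := reachable_add_right ((2 ^ (m - n) - (m - n)) • Pi.single (path 0) 1) hfam
  rw [add_assoc, ← add_smul, Nat.add_sub_cancel' Nat.lt_two_pow_self.le] at hv
  have hw := hv.trans (reachable_add Relation.ReflTransGen.refl
    (reachable_path a (m - n) (Nat.lt_succ_self _)))
  have hC : coverConfig n m = (∑ i, 8 • Pi.single (fam i) 1 +
      (2 ^ (m - n) - (m - n)) • Pi.single (path 0) 1) + fun x => match x with
        | Sum.inl _ => 0
        | Sum.inr (Sum.inr (Sum.inr (Sum.inr k))) =>
            if (k : ℕ) = 0 then 1 else if (k : ℕ) = m - n then 0 else 1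
        | _ => 1 := by
    funext x
    rcases x with j | i | i | i | k
    · simp [coverConfig]
    · simp [coverConfig, Pi.single_apply]
    · simp [coverConfig]
    · simp [coverConfig]
    · by_cases hk : k = 0
      · simp [coverConfig, hk]
      · have hk' : (k : ℕ) ≠ 0 := fun h => hk (Fin.ext h)
        simp [coverConfig, hk]
  rw [hC]
  refine ⟨_, reachable_add_right _ hw, ?_⟩
  rintro (j | i | i | i | k)
  · obtain ⟨i, hi, hj⟩ := Finset.mem_biUnion.1 (hcover ▸ Finset.mem_univ j)
    have h₁ : 1 ≤ ∑ j' ∈ a i, (Pi.single (elt j') 1 : CoverVtx n m → ℕ) (elt j) := by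
      refine le_trans ?_ (Finset.single_le_sum
        (f := fun j' => (Pi.single (elt j') 1 : CoverVtx n m → ℕ) (elt j))
        (fun _ _ => Nat.zero_le _) hj)
      simp
    have h₂ := Finset.single_le_sum
      (f := fun i => ∑ j' ∈ a i, (Pi.single (elt j') 1 : CoverVtx n m → ℕ) (elt j))
      (fun _ _ => Nat.zero_le _) hi
    simp only [Pi.add_apply, Finset.sum_apply]
    exact (h₁.trans h₂).trans ((Nat.le_add_right _ _).trans (Nat.le_add_right _ _))
  · simp
  · simp
  · simp
  · by_cases hk : k = ⟨m - n, Nat.lt_succ_self _⟩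
    · subst hk
      simp only [Pi.add_apply, Pi.single_eq_same]
      omega
    · have hk' : (k : ℕ) ≠ m - n := fun h => hk (Fin.ext h)
      simp [hk']

/-- Let `S` have `4n` elements and let `A = {a_1, …, a_m}` (`m ≥ n`) be a family of
distinct 4-element subsets of `S`.  Then the configuration `C'` on the graph `G'`
constructed from `(S, A)` is cover solvable if and only if `A` contains an exact
cover of `S`: a subfamily of `n` pairwise disjoint members of `A` whose union is
`S`. -/
theorem coverConfig_solvable_iff_exactCover (n m : ℕ) (hm : n ≤ m)
    (a : Fin m → Finset (Fin (4 * n)))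
    (ha4 : ∀ i, (a i).card = 4) (hainj : Function.Injective a) :
    CoverSolvable (coverGraph n m a) (coverConfig n m) ↔
      ∃ I : Finset (Fin m), I.card = n ∧
        (∀ i ∈ I, ∀ j ∈ I, i ≠ j → Disjoint (a i) (a j)) ∧
        I.biUnion a = Finset.univ := by
  exact ⟨exists_exactCover_of_coverSolvable hm ha4,
    fun ⟨_, hcard, _, hcover⟩ => coverSolvable_of_exactCover ha4 hcard hcover⟩
end

section
/- There exist sequences α_n = O(1/n) and ℓ_n = O(log n / n) such that, for t = t(n) with t(n)/n bounded between positive constants (in particular for t = γn ± φ(n)√n with γ = (1+√5)/2 and φ(n) = o(√n)), when a configuration of weight t on n vertices is chosen uniformly at random from all C(n+t−1, n−1) configurations (Bose Einstein scheme), the expected number E(X) of vertices carrying an odd number of pebbles satisfies (1 + ℓ_n)·nt/(n+2t) ≤ E(X) ≤ (1 + α_n)·nt/(n+2t). -/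
/-- The expected number of odd stacks when a configuration of weight `t` on `n`
vertices is chosen uniformly at random among all `C(n+t−1, n−1)` configurations
(Bose Einstein scheme). -/
noncomputable def beExpOddStacks (n t : ℕ) : ℝ :=
  (∑ C ∈ configs n t, (oddStacks C : ℝ)) / ((n + t - 1).choose (n - 1) : ℝ)

/-- There are `C(n+t, n)` configurations of weight `t` on `n + 1` vertices. -/
theorem card_configs_succ (n t : ℕ) : (configs (n + 1) t).card = (n + t).choose n := by
  have h : (configs (n + 1) t).card =
      ((Finset.univ : Finset (Fin (n + 1))).finsuppAntidiag t).card := by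
    refine (Finset.card_bij (fun (f : Fin (n + 1) →₀ ℕ) _ => (f : Fin (n + 1) → ℕ)) ?_ ?_ ?_).symm
    · intro f hf
      simpa [configs, Finset.Nat.mem_antidiagonalTuple] using hf
    · intro f _ g _ h
      exact DFunLike.coe_injective h
    · intro C hC
      refine ⟨Finsupp.equivFunOnFinite.symm C, ?_, by simp⟩
      simpa [configs, Finset.Nat.mem_antidiagonalTuple] using hC
  rw [h, Finset.card_finsuppAntidiag_nat_eq_choose, Finset.card_univ, Fintype.card_fin,
    Nat.add_right_comm, Nat.add_sub_cancel, Nat.choose_symm_add]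

/-- Adding a pebble to the vertex `v` turns even stacks at `v` into odd ones. -/
theorem card_odd_configs_succ {n : ℕ} (t : ℕ) (v : Fin n) :
    ((configs n (t + 1)).filter fun C => Odd (C v)).card =
      ((configs n t).filter fun C => ¬ Odd (C v)).card := by
  symm
  refine Finset.card_bij (fun C _ => C + Pi.single v 1) ?_ ?_ ?_
  · intro C hC
    simp only [configs, Finset.mem_filter, Finset.Nat.mem_antidiagonalTuple] at hC ⊢
    simp [Finset.sum_add_distrib, hC.1, Nat.odd_add_one, hC.2]
  · intro C _ D _ h
    exact add_right_cancel h
  · intro C hC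
    simp only [configs, Finset.mem_filter, Finset.Nat.mem_antidiagonalTuple] at hC
    have hle : Pi.single v 1 ≤ C := by
      intro w
      by_cases hw : w = v
      · subst hw
        simpa [Nat.one_le_iff_ne_zero] using hC.2.pos.ne'
      · simp [hw]
    have hC' : C - Pi.single v 1 + Pi.single v 1 = C := tsub_add_cancel_of_le hle
    refine ⟨C - Pi.single v 1, ?_, hC'⟩
    have hsum : ∑ w, (C - Pi.single v 1 + Pi.single v 1 : Fin n → ℕ) w = t + 1 := by rw [hC', hC.1]
    have hodd : Odd ((C - Pi.single v 1 + Pi.single v 1 : Fin n → ℕ) v) := by rw [hC']; exact hC.2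
    simp only [Pi.add_apply, Finset.sum_add_distrib, Finset.sum_pi_single', Finset.mem_univ,
      if_true, Nat.add_right_cancel_iff] at hsum
    rw [Pi.add_apply, Pi.single_eq_same, Nat.odd_add_one] at hodd
    simp only [configs, Finset.mem_filter, Finset.Nat.mem_antidiagonalTuple]
    exact ⟨hsum, hodd⟩

theorem sum_oddStacks (n t : ℕ) :
    ∑ C ∈ configs n t, oddStacks C =
      ∑ v : Fin n, ((configs n t).filter fun C => Odd (C v)).card := by
  simp only [oddStacks, Finset.card_filter]
  exact Finset.sum_comm

theorem sum_oddStacks_succ (n t : ℕ) :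
    ∑ C ∈ configs n (t + 1), oddStacks C + ∑ C ∈ configs n t, oddStacks C =
      n * (configs n t).card := by
  rw [sum_oddStacks, sum_oddStacks, ← Finset.sum_add_distrib]
  simp_rw [card_odd_configs_succ, add_comm (Finset.card (Finset.filter (fun C => ¬ _) _)),
    Finset.card_filter_add_card_filter_not]
  simp

theorem beExpOddStacks_zero (n : ℕ) : beExpOddStacks n 0 = 0 := by
  simp [beExpOddStacks, configs, oddStacks, Finset.Nat.antidiagonalTuple_zero_right]

theorem beExpOddStacks_succ (n t : ℕ) :
    beExpOddStacks (n + 1) (t + 1) =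
      ((n : ℝ) + 1 - beExpOddStacks (n + 1) t) * ((t + 1) / (n + t + 1)) := by
  have hsum : (∑ C ∈ configs (n + 1) (t + 1), (oddStacks C : ℝ)) +
      ∑ C ∈ configs (n + 1) t, (oddStacks C : ℝ) = (n + 1) * ((n + t).choose n : ℝ) := by
    have h := sum_oddStacks_succ (n + 1) t
    rw [card_configs_succ] at h
    exact_mod_cast h
  have hch : ((n + t).choose n : ℝ) * (n + t + 1) = ((n + t + 1).choose n : ℝ) * (t + 1) := by
    have h := Nat.choose_mul_succ_eq (n + t) n
    rw [show n + t + 1 - n = t + 1 by omega] at h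
    exact_mod_cast h
  have h₀ : (0 : ℝ) < (n + t).choose n := by
    exact_mod_cast Nat.choose_pos (Nat.le_add_right n t)
  have h₁ : (0 : ℝ) < (n + t + 1).choose n := by
    exact_mod_cast Nat.choose_pos (by omega)
  have h₂ : (0 : ℝ) < n + t + 1 := by positivity
  simp only [beExpOddStacks, Nat.add_sub_cancel,
    show n + 1 + (t + 1) - 1 = n + t + 1 by omega, show n + 1 + t - 1 = n + t by omega]
  rw [eq_sub_of_add_eq hsum]
  field_simp
  linear_combination (((n : ℝ) + 1) * (n + t).choose n -
    ∑ C ∈ configs (n + 1) t, (oddStacks C : ℝ)) * hch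

/-- The expected number of odd stacks differs from `nt/(n+2t)` by at most `1 + t/(n-1)`. -/
theorem abs_beExpOddStacks_sub_le (n t : ℕ) :
    n * |beExpOddStacks (n + 1) t - ((n : ℝ) + 1) * t / (n + 1 + 2 * t)| ≤ n + t := by
  induction t with
  | zero => simp [beExpOddStacks_zero]
  | succ t ih =>
    set F := beExpOddStacks (n + 1) t - ((n : ℝ) + 1) * t / (n + 1 + 2 * t) with hF
    set r : ℝ := (t + 1) / (n + t + 1) with hr
    set δ : ℝ := ((n : ℝ) + 1) * (2 * (t + 1)) / ((n + 1 + 2 * t) * (n + 1 + 2 * (t + 1))) with hδ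
    have hrec : beExpOddStacks (n + 1) (t + 1) -
        ((n : ℝ) + 1) * ((t + 1 : ℕ) : ℝ) / (n + 1 + 2 * ((t + 1 : ℕ) : ℝ)) = δ - r * F := by
      rw [beExpOddStacks_succ, hF, hr, hδ]
      push_cast
      field_simp
      ring
    have hr₀ : 0 ≤ r := by positivity
    have hδ₀ : 0 ≤ δ := by positivity
    have hδ₁ : δ ≤ 1 := by
      rw [hδ, div_le_one (by positivity)]
      have : (0 : ℝ) ≤ t := t.cast_nonneg
      have : (0 : ℝ) ≤ n := n.cast_nonneg
      exact mul_le_mul (by linarith) (by linarith) (by positivity) (by positivity)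
    have hrt : r * (n + t) ≤ t + 1 := by
      rw [hr, div_mul_eq_mul_div, div_le_iff₀ (by positivity)]
      nlinarith [n.cast_nonneg (α := ℝ), t.cast_nonneg (α := ℝ)]
    rw [hrec]
    calc (n : ℝ) * |δ - r * F| ≤ n * (1 + r * |F|) := by
          gcongr
          refine (abs_sub _ _).trans ?_
          rw [abs_mul, abs_of_nonneg hr₀, abs_of_nonneg hδ₀]
          gcongr
      _ = n + r * (n * |F|) := by ring
      _ ≤ n + r * (n + t) := by gcongr
      _ ≤ n + ((t + 1 : ℕ) : ℝ) := by push_cast; gcongr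

theorem one_div_isBigO_log_div :
    (fun n : ℕ => 1 / (n : ℝ)) =O[Filter.atTop] fun n : ℕ => Real.log n / (n : ℝ) := by
  have h : (fun n : ℕ => (1 : ℝ)) =O[Filter.atTop] fun n : ℕ => Real.log n :=
    Real.isLittleO_const_log_atTop.isBigO.comp_tendsto tendsto_natCast_atTop_atTop
  simpa only [div_eq_mul_inv] using h.mul (Asymptotics.isBigO_refl (fun n : ℕ => (n : ℝ)⁻¹) _)

/-- For any sequence `t(n)` of pebble numbers with `t(n)/n` bounded between
positive constants (in particular for `t = γn ± φ(n)√n` with `φ(n) = o(√n)`),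
there are sequences `α_n = O(1/n)` and `ℓ_n = O(log n / n)` such that the
expected number of odd stacks in the Bose Einstein scheme satisfies
`(1 + ℓ_n)·nt/(n+2t) ≤ E(X) ≤ (1 + α_n)·nt/(n+2t)` for all `n ≥ 1`. -/
theorem beExpOddStacks_bounds (t : ℕ → ℕ) (c₁ c₂ : ℝ) (hc₁ : 0 < c₁) (hc : c₁ ≤ c₂)
    (hbd : ∀ n : ℕ, 1 ≤ n → c₁ ≤ (t n : ℝ) / n ∧ (t n : ℝ) / n ≤ c₂) :
    ∃ α ℓ : ℕ → ℝ,
      Asymptotics.IsBigO Filter.atTop α (fun n : ℕ => 1 / (n : ℝ)) ∧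
      Asymptotics.IsBigO Filter.atTop ℓ (fun n : ℕ => Real.log n / (n : ℝ)) ∧
      ∀ n : ℕ, 1 ≤ n →
        (1 + ℓ n) * ((n : ℝ) * (t n : ℝ) / ((n : ℝ) + 2 * (t n : ℝ))) ≤ beExpOddStacks n (t n) ∧
        beExpOddStacks n (t n) ≤ (1 + α n) * ((n : ℝ) * (t n : ℝ) / ((n : ℝ) + 2 * (t n : ℝ))) := by
  have hpos : ∀ n : ℕ, 1 ≤ n → (0 : ℝ) < n ∧ (0 : ℝ) < t n := by
    intro n hn
    have hn' : (0 : ℝ) < n := by exact_mod_cast hn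
    exact ⟨hn', (mul_pos hc₁ hn').trans_le ((le_div_iff₀ hn').1 (hbd n hn).1)⟩
  set M : ℕ → ℝ := fun n => (n : ℝ) * (t n : ℝ) / ((n : ℝ) + 2 * (t n : ℝ)) with hM
  have hMpos : ∀ n : ℕ, 1 ≤ n → 0 < M n := by
    intro n hn
    obtain ⟨h₁, h₂⟩ := hpos n hn
    positivity
  set α : ℕ → ℝ := fun n => (beExpOddStacks n (t n) - M n) / M n with hα
  have hαO : α =O[Filter.atTop] fun n : ℕ => 1 / (n : ℝ) := by
    refine Asymptotics.IsBigO.of_bound ((1 + 2 * c₂) * (1 / c₁ + 2)) ?_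
    filter_upwards [Filter.eventually_ge_atTop 2] with n hn
    have hn₁ : 1 ≤ n := by omega
    obtain ⟨hn₀, ht₀⟩ := hpos n hn₁
    have hlo : c₁ * n ≤ t n := (le_div_iff₀ hn₀).1 (hbd n hn₁).1
    have hhi : (t n : ℝ) ≤ c₂ * n := (div_le_iff₀ hn₀).1 (hbd n hn₁).2
    have hc₂ : 0 < c₂ := hc₁.trans_le hc
    have hn₂ : (2 : ℝ) ≤ n := by exact_mod_cast hn
    have herr : |beExpOddStacks n (t n) - M n| ≤ 1 + 2 * c₂ := by
      have h := abs_beExpOddStacks_sub_le (n - 1) (t n)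
      rw [Nat.sub_add_cancel hn₁, Nat.cast_sub hn₁, Nat.cast_one, sub_add_cancel] at h
      have h' : ((n : ℝ) - 1) * |beExpOddStacks n (t n) - M n| ≤ (n - 1) * (1 + 2 * c₂) :=
        h.trans (by nlinarith)
      exact le_of_mul_le_mul_left h' (by linarith)
    have hinv : 1 / M n ≤ (1 / c₁ + 2) * (1 / n) := by
      have : 1 / M n = (n / t n + 2) * (1 / n) := by
        simp only [hM]
        field_simp
      rw [this]
      gcongr ?_ * _
      gcongr ?_ + _
      rw [div_le_div_iff₀ ht₀ hc₁]
      linarith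
    have hM₀ := hMpos n hn₁
    rw [Real.norm_eq_abs, Real.norm_eq_abs, abs_of_pos (one_div_pos.2 hn₀), hα, abs_div,
      abs_of_pos hM₀, div_eq_mul_one_div, mul_assoc]
    gcongr
  have hE : ∀ n : ℕ, 1 ≤ n → (1 + α n) * M n = beExpOddStacks n (t n) := by
    intro n hn
    have := (hMpos n hn).ne'
    simp only [hα]
    field_simp
    ring
  exact ⟨α, α, hαO, hαO.trans one_div_isBigO_log_div, fun n hn => ⟨(hE n hn).le, (hE n hn).ge⟩⟩
end
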